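/- arXiv:2601.19701 — 3 statements merged into one kernel-verified Lean document; each statement's English description precedes it below -/
import Mathlib

section
/- Let d ∈ {2,3}. Let (h_n) ⊂ (0,1) with h_n → 0⁺ and h_n^{−2} ∉ {λ_ℓ² : ℓ ∈ ℕ} for all n (so σ_n := σ(h_n) ∈ (0,1)); write ℓ_n := ℓ(h_n). Assume (β_n) = ((β_{n,+}, β_{n,−})) ⊂ ℂ² converges to β = (β₊, β₋), that ρ := (−1)^{ℓ_n} is constant in n, and that σ_n → σ ∈ (0,1). Set C_{σ,β,ρ}² := Σ_{k∈ℤ} |β₊ + (−1)^k ρ β₋|²/(k−σ)². Then there exists C > 1 such that for every integer Υ ≥ 1 there exists ν ∈ ℕ such that for all n ≥ ν: |Σ_{|k|≤Υ} |β_{n,+} + (−1)^{ℓ_n+k} β_{n,−}|² · m_{ℓ_n+k}/(λ_{ℓ_n+k}² − h_n^{−2})² − C_{σ,β,ρ}² h_n^{3−d}/(2(d−1))| ≤ C h_n^{3−d}(Υ h_n + |σ_n − σ| + |β_n − β| + Υ^{−1}). -/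
open Filter

/-- The squared Laplace eigenvalue `λ_ℓ² = ℓ(ℓ+d−1)` on `S^d`, extended to integer index. -/
noncomputable def lam2 (d : ℕ) (l : ℤ) : ℝ := (l : ℝ) * ((l : ℝ) + (d : ℝ) - 1)

/-- The multiplicity `m_ℓ` (`2ℓ+1` if `d = 2`, `(ℓ+1)²` if `d = 3`), extended to integer
index. -/
noncomputable def mult (d : ℕ) (l : ℤ) : ℝ :=
  if d = 2 then 2 * (l : ℝ) + 1 else ((l : ℝ) + 1) ^ 2

theorem norm_add_unit_mul_le (x : ℂ × ℂ) {ε : ℂ} (hε : ‖ε‖ = 1) :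
    ‖x.1 + ε * x.2‖ ≤ 2 * ‖x‖ := by
  have h1 := norm_add_le x.1 (ε * x.2)
  rw [norm_mul, hε, one_mul] at h1
  linarith [norm_fst_le x, norm_snd_le x]

theorem abs_sq_norm_add_unit_mul_sub_le (x y : ℂ × ℂ) {ε : ℂ} (hε : ‖ε‖ = 1) :
    |‖x.1 + ε * x.2‖ ^ 2 - ‖y.1 + ε * y.2‖ ^ 2| ≤ 4 * ‖x - y‖ * (‖x‖ + ‖y‖) := by
  have hx := norm_add_unit_mul_le x hε
  have hy := norm_add_unit_mul_le y hε
  have hxy := norm_add_unit_mul_le (x - y) hε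
  have hd := abs_norm_sub_norm_le (x.1 + ε * x.2) (y.1 + ε * y.2)
  rw [show x.1 + ε * x.2 - (y.1 + ε * y.2) = (x - y).1 + ε * (x - y).2 by
    simp only [Prod.fst_sub, Prod.snd_sub]; ring] at hd
  rw [sq_sub_sq, abs_mul, abs_of_nonneg (by positivity)]
  calc _ ≤ (2 * ‖x‖ + 2 * ‖y‖) * (2 * ‖x - y‖) := by gcongr; exact hd.trans hxy
    _ = _ := by ring

/-- Distance from `k` to a point of `[δ, 1 - δ]`, compared with the weight `1 + k²`. -/
theorem inv_int_sub_sq_le {δ s : ℝ} (hδ : 0 < δ) (h1 : δ ≤ s) (h2 : s ≤ 1 - δ) (k : ℤ) :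
    δ ≤ |(k : ℝ) - s| ∧ (((k : ℝ) - s) ^ 2)⁻¹ ≤ 2 / δ ^ 2 * (1 + (k : ℝ) ^ 2)⁻¹ := by
  have key : δ ≤ |(k : ℝ) - s| ∧ δ * |(k : ℝ)| ≤ |(k : ℝ) - s| := by
    rcases lt_trichotomy k 0 with hk | rfl | hk
    · have hk' : (k : ℝ) ≤ -1 := by exact_mod_cast Int.le_sub_one_of_lt hk
      rw [abs_of_nonpos (by linarith : (k : ℝ) - s ≤ 0), abs_of_nonpos (by linarith)]
      constructor <;> nlinarith
    · simp only [Int.cast_zero, zero_sub, abs_neg, abs_zero, mul_zero, abs_nonneg, and_true]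
      exact h1.trans (le_abs_self s)
    · have hk' : (1 : ℝ) ≤ k := by exact_mod_cast hk
      rw [abs_of_nonneg (by linarith : 0 ≤ (k : ℝ) - s), abs_of_nonneg (by linarith)]
      constructor <;> nlinarith
  refine ⟨key.1, ?_⟩
  have e1 : δ ^ 2 ≤ ((k : ℝ) - s) ^ 2 := by
    rw [← sq_abs ((k : ℝ) - s)]; exact pow_le_pow_left₀ hδ.le key.1 2
  have e2 : δ ^ 2 * (k : ℝ) ^ 2 ≤ ((k : ℝ) - s) ^ 2 := by
    rw [← sq_abs ((k : ℝ) - s), ← sq_abs (k : ℝ), ← mul_pow]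
    exact pow_le_pow_left₀ (by positivity) key.2 2
  have hpos : 0 < ((k : ℝ) - s) ^ 2 := by nlinarith [pow_pos hδ 2]
  rw [← div_eq_mul_inv, div_div, inv_eq_one_div, div_le_div_iff₀ hpos (by positivity)]
  linarith

theorem abs_inv_sq_sub_inv_sq_le {δ a b w : ℝ} (hδ : 0 < δ) (ha : δ ≤ |a|) (hb : δ ≤ |b|)
    (ha' : (a ^ 2)⁻¹ ≤ w) (hb' : (b ^ 2)⁻¹ ≤ w) :
    |(a ^ 2)⁻¹ - (b ^ 2)⁻¹| ≤ |a - b| * (2 / δ * w) := by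
  have ha0 : a ≠ 0 := abs_pos.1 (hδ.trans_le ha)
  have hb0 : b ≠ 0 := abs_pos.1 (hδ.trans_le hb)
  have e : (a ^ 2)⁻¹ - (b ^ 2)⁻¹ = -((a - b) * (a⁻¹ * (b ^ 2)⁻¹ + b⁻¹ * (a ^ 2)⁻¹)) := by
    field_simp
    ring
  rw [e, abs_neg, abs_mul]
  gcongr
  have hai : |a⁻¹| ≤ 1 / δ := by
    rw [abs_inv, inv_eq_one_div]; exact one_div_le_one_div_of_le hδ ha
  have hbi : |b⁻¹| ≤ 1 / δ := by
    rw [abs_inv, inv_eq_one_div]; exact one_div_le_one_div_of_le hδ hb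
  calc _ ≤ |a⁻¹| * |(b ^ 2)⁻¹| + |b⁻¹| * |(a ^ 2)⁻¹| := by
        rw [← abs_mul, ← abs_mul]; exact abs_add_le _ _
    _ ≤ 1 / δ * w + 1 / δ * w := by
        rw [abs_of_nonneg (by positivity : 0 ≤ (b ^ 2)⁻¹),
          abs_of_nonneg (by positivity : 0 ≤ (a ^ 2)⁻¹)]
        gcongr
    _ = 2 / δ * w := by ring

theorem summable_int_inv_one_add_sq : Summable fun k : ℤ => (1 + (k : ℝ) ^ 2)⁻¹ := by
  have h0 : Summable fun n : ℕ => (1 + (n : ℝ) ^ 2)⁻¹ := by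
    refine Summable.of_nonneg_of_le (fun n => by positivity) (fun n => ?_)
      ((summable_nat_add_iff 1).2 (Real.summable_nat_pow_inv.2 one_lt_two) |>.mul_left 2)
    rw [← div_eq_mul_inv, inv_eq_one_div, div_le_div_iff₀ (by positivity) (by positivity)]
    push_cast
    nlinarith [sq_nonneg ((n : ℝ) - 1)]
  exact Summable.of_nat_of_neg (by simpa using h0) (by simpa using h0)

/-- The symmetric partial sums of a series dominated by `K / (1 + k²)` converge at rate
`2 K / N`. -/
theorem abs_sum_Icc_sub_tsum_le {F : ℤ → ℝ} {K : ℝ}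
    (hF : ∀ k, |F k| ≤ K * (1 + (k : ℝ) ^ 2)⁻¹) {N : ℕ} (hN : 1 ≤ N) :
    |∑ k ∈ Finset.Icc (-(N : ℤ)) N, F k - ∑' k, F k| ≤ 2 * K * (N : ℝ)⁻¹ := by
  have hK : 0 ≤ K := by simpa using (abs_nonneg _).trans (hF 0)
  have hsum : Summable F :=
    Summable.of_norm_bounded (summable_int_inv_one_add_sq.mul_left K) hF
  have hlim : Tendsto (fun M : ℕ => ∑ k ∈ Finset.Icc (-(M : ℤ)) M, F k) atTop
      (nhds (∑' k, F k)) :=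
    hsum.hasSum.comp Finset.tendsto_Icc_neg
  have hpart : ∀ M ≥ N, |∑ k ∈ Finset.Icc (-(N : ℤ)) N, F k - ∑ k ∈ Finset.Icc (-(M : ℤ)) M, F k|
      ≤ 2 * K * ((N : ℝ)⁻¹ - (M : ℝ)⁻¹) := by
    intro M hM
    induction M, hM using Nat.le_induction with
    | base => simp
    | succ M hM ih =>
      have hM0 : (0 : ℝ) < M := by exact_mod_cast hN.trans hM
      have hins : Finset.Icc (-((M + 1 : ℕ) : ℤ)) ((M + 1 : ℕ) : ℤ) =
          insert (-((M + 1 : ℕ) : ℤ)) (insert ((M + 1 : ℕ) : ℤ) (Finset.Icc (-(M : ℤ)) M)) := by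
        ext x
        simp only [Finset.mem_Icc, Finset.mem_insert]
        omega
      rw [hins, Finset.sum_insert (by simp only [Finset.mem_Icc, Finset.mem_insert]; omega),
        Finset.sum_insert (by simp only [Finset.mem_Icc]; omega)]
      have h1 := hF (-((M + 1 : ℕ) : ℤ))
      have h2 := hF ((M + 1 : ℕ) : ℤ)
      push_cast at h1 h2 ih ⊢
      rw [neg_sq] at h1
      have h3 : (1 + ((M : ℝ) + 1) ^ 2)⁻¹ ≤ (M : ℝ)⁻¹ - ((M : ℝ) + 1)⁻¹ := by
        rw [inv_sub_inv hM0.ne' (by positivity), inv_eq_one_div,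
          div_le_div_iff₀ (by positivity) (by positivity)]
        nlinarith
      have h4 := mul_le_mul_of_nonneg_left h3 hK
      rw [abs_le] at *
      constructor <;> linarith
  refine le_of_tendsto ((tendsto_const_nhds.sub hlim).abs) ?_
  filter_upwards [eventually_ge_atTop N] with M hM
  refine (hpart M hM).trans ?_
  gcongr
  linarith [inv_nonneg.2 (Nat.cast_nonneg (α := ℝ) M)]

theorem two_div_le_and_abs_le {q h t T : ℝ} (hq : 0 < q) (hh : 0 < h) (hqh : 4 ≤ (q * h) ^ 2)
    (ht : |t| ≤ 2 * T) (hTh : 2 * T * h ≤ 1) :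
    2 ≤ q * h ∧ 2 * |t| ≤ q ∧ 0 < q + t ∧ q ^ 2 ≤ 4 * (q + t) ^ 2 := by
  have h2 : 2 ≤ q * h := by nlinarith [mul_pos hq hh]
  have htq : 2 * |t| ≤ q := by
    have h3 : |t| * h ≤ 1 := (mul_le_mul_of_nonneg_right ht hh.le).trans hTh
    exact le_of_mul_le_mul_right (by linarith : 2 * |t| * h ≤ q * h) hh
  have hqt : q ≤ 2 * (q + t) := by linarith [neg_abs_le t]
  exact ⟨h2, htq, by linarith, by nlinarith⟩

theorem abs_add_two_mul_div_sq_sub_le {q h t T : ℝ} (hq : 0 < q) (hh : 0 < h)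
    (hqh : (q * h) ^ 2 = 4 + h ^ 2) (ht : |t| ≤ 2 * T) (hT : 1 ≤ T) (hTh : 2 * T * h ≤ 1) :
    |(q + 2 * t) / (q + t) ^ 2 - h / 2| ≤ 4 * T * h * h := by
  have h4 : 4 ≤ (q * h) ^ 2 := by rw [hqh]; linarith [sq_nonneg h]
  obtain ⟨hqh2, htq, hqt, h3⟩ := two_div_le_and_abs_le hq hh h4 ht hTh
  have e1 : (q + 2 * t) / (q + t) ^ 2 = 1 / q - t ^ 2 / (q * (q + t) ^ 2) := by
    field_simp; ring
  have e2 : t ^ 2 / (q * (q + t) ^ 2) ≤ T * h ^ 2 := by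
    rw [div_le_iff₀ (by positivity)]
    have h1 : t ^ 2 ≤ T * q := by
      calc t ^ 2 = |t| * |t| := by rw [abs_mul_abs_self, sq]
        _ ≤ 2 * T * (q / 2) := by gcongr; linarith
        _ = T * q := by ring
    have h5 : 1 ≤ h ^ 2 * (q + t) ^ 2 := by
      linarith [mul_le_mul_of_nonneg_left h3 (sq_nonneg h), mul_pow q h 2]
    linarith [mul_le_mul_of_nonneg_left h5 (by positivity : 0 ≤ T * q)]
  have e3 : 0 ≤ t ^ 2 / (q * (q + t) ^ 2) := by positivity
  have e4 : 1 / q ≤ h / 2 := by rw [div_le_div_iff₀ hq two_pos]; linarith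
  have e5 : h / 2 - h ^ 2 ≤ 1 / q := by
    rw [le_div_iff₀ hq]
    have h1 : q * h ≤ 2 + h := by nlinarith [mul_pos hq hh]
    linarith [mul_le_mul_of_nonneg_right hqh2 hh.le]
  have e6 : h ^ 2 ≤ T * h ^ 2 := le_mul_of_one_le_left (sq_nonneg h) hT
  rw [e1, show 4 * T * h * h = 4 * (T * h ^ 2) by ring, abs_le]
  have := sq_nonneg h
  constructor <;> linarith

theorem abs_half_add_sq_div_sq_sub_le {q h t T : ℝ} (hq : 0 < q) (hh : 0 < h)
    (hqh : 4 ≤ (q * h) ^ 2) (ht : |t| ≤ 2 * T) (hTh : 2 * T * h ≤ 1) :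
    |(q / 2 + t) ^ 2 / (q + t) ^ 2 - 1 / 4| ≤ 4 * T * h := by
  obtain ⟨hqh2, htq, hqt, h3⟩ := two_div_le_and_abs_le hq hh hqh ht hTh
  have hT : 0 ≤ T := by linarith [abs_nonneg t]
  have e1 : (q / 2 + t) ^ 2 / (q + t) ^ 2 - 1 / 4 =
      t * (2 * q + 3 * t) / (4 * (q + t) ^ 2) := by
    field_simp; ring
  rw [e1]
  have e2 : |2 * q + 3 * t| ≤ 4 * q := by
    rw [abs_le]; constructor <;> linarith [neg_abs_le t, le_abs_self t]
  rw [abs_div, abs_mul, abs_of_pos (by positivity : 0 < 4 * (q + t) ^ 2),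
    div_le_iff₀ (by positivity)]
  calc |t| * |2 * q + 3 * t| ≤ 2 * T * (4 * q) := by gcongr
    _ ≤ 2 * T * (4 * q) * (q * h / 2) := le_mul_of_one_le_right (by positivity) (by linarith)
    _ = 4 * T * h * q ^ 2 := by ring
    _ ≤ _ := by gcongr

/-- With `q = 2 (ℓ + s) + d - 1` and `t = k - s`, the spectral gap factors as `t * (q + t)` and
the remaining factor of the summand is close to `h ^ (3 - d) / (2 (d - 1))`. -/
theorem abs_mult_div_sub_le {d : ℕ} (hd : d = 2 ∨ d = 3) {h s T : ℝ} {l k : ℤ}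
    (hh : 0 < h) (hp : 0 ≤ (l : ℝ) + s)
    (heq : h ^ (-2 : ℤ) = ((l : ℝ) + s) * ((l : ℝ) + s + (d : ℝ) - 1))
    (ht : |(k : ℝ) - s| ≤ 2 * T) (hT : 1 ≤ T) (hTh : 2 * T * h ≤ 1) :
    |mult d (l + k) / (2 * ((l : ℝ) + s) + d - 1 + (k - s)) ^ 2
        - h ^ ((3 : ℤ) - (d : ℤ)) / (2 * ((d : ℝ) - 1))|
      ≤ 4 * T * h * h ^ ((3 : ℤ) - (d : ℤ)) := by
  rw [zpow_neg, zpow_ofNat] at heq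
  rcases hd with rfl | rfl
  · have hqh : ((2 * ((l : ℝ) + s) + 1) * h) ^ 2 = 4 + h ^ 2 := by
      have : (2 * ((l : ℝ) + s) + 1) ^ 2 = 4 * (h ^ 2)⁻¹ + 1 := by rw [heq]; push_cast; ring
      rw [mul_pow, this]; field_simp
    convert abs_add_two_mul_div_sq_sub_le (by linarith) hh hqh ht hT hTh using 1
    · simp only [mult, if_true]
      norm_num
      ring_nf
    · norm_num
  · have hqh : ((2 * ((l : ℝ) + s) + 2) * h) ^ 2 = 4 + 4 * h ^ 2 := by
      have : (2 * ((l : ℝ) + s) + 2) ^ 2 = 4 * (h ^ 2)⁻¹ + 4 := by rw [heq]; push_cast; ring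
      rw [mul_pow, this]; field_simp
    convert abs_half_add_sq_div_sq_sub_le (q := 2 * ((l : ℝ) + s) + 2) (by linarith) hh
      (by rw [hqh]; linarith [sq_nonneg h]) ht hTh using 1
    · simp only [mult, show (3 : ℕ) ≠ 2 by norm_num, if_false]
      norm_num
      ring_nf
    · norm_num

theorem abs_mul_mul_sub_le {A A₀ R R₀ u u₀ B H δ x y z w : ℝ}
    (hδ : 0 < δ) (hδ1 : δ ≤ 1) (hB : 1 ≤ B) (hH : 0 ≤ H) (hx : 0 ≤ x) (hy : 0 ≤ y) (hz : 0 ≤ z)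
    (hw : 0 ≤ w) (hA : |A - A₀| ≤ 8 * x * B) (hA₀ : |A₀| ≤ 4 * B ^ 2)
    (hR : |R| ≤ 3 * H) (hRR : |R - R₀| ≤ 4 * y * H) (hR₀ : |R₀| ≤ H / 2)
    (hu : |u| ≤ 2 / δ ^ 2 * w) (huu : |u - u₀| ≤ z * (4 / δ ^ 3 * w)) :
    |A * R * u - A₀ * R₀ * u₀| ≤ 48 * B ^ 2 / δ ^ 3 * H * (y + z + x) * w := by
  have hB2 : B ≤ B ^ 2 := by nlinarith
  have hδ2 : 1 / δ ^ 2 ≤ 1 / δ ^ 3 :=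
    one_div_le_one_div_of_le (by positivity) (pow_le_pow_of_le_one hδ.le hδ1 (by norm_num))
  calc |A * R * u - A₀ * R₀ * u₀|
      = |(A - A₀) * R * u + A₀ * (R - R₀) * u + A₀ * R₀ * (u - u₀)| := by ring_nf
    _ ≤ |A - A₀| * |R| * |u| + |A₀| * |R - R₀| * |u| + |A₀| * |R₀| * |u - u₀| := by
        simp only [← abs_mul]; exact abs_add_three _ _ _
    _ ≤ 8 * x * B * (3 * H) * (2 / δ ^ 2 * w) + 4 * B ^ 2 * (4 * y * H) * (2 / δ ^ 2 * w)
        + 4 * B ^ 2 * (H / 2) * (z * (4 / δ ^ 3 * w)) := by gcongr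
    _ = 48 * B * (1 / δ ^ 2) * H * x * w + 32 * B ^ 2 * (1 / δ ^ 2) * H * y * w
        + 8 * B ^ 2 * (1 / δ ^ 3) * H * z * w := by ring
    _ ≤ 48 * B ^ 2 * (1 / δ ^ 3) * H * x * w + 48 * B ^ 2 * (1 / δ ^ 3) * H * y * w
        + 48 * B ^ 2 * (1 / δ ^ 3) * H * z * w := by gcongr <;> norm_num
    _ = _ := by ring

/-- Scenario 1 norm asymptotics: with `β_n → β`, `ρ = (−1)^{ℓ_n}`
constant, and `σ_n → σ ∈ (0,1)`, the spectral window sum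
`Σ_{|k|≤Υ} |β_{n,+} + (−1)^{ℓ_n+k} β_{n,−}|² m_{ℓ_n+k}/(λ_{ℓ_n+k}² − h_n⁻²)²`
equals `C_{σ,β,ρ}² h_n^{3−d}/(2(d−1))` up to the stated error. -/
theorem stmt_6 (d : ℕ) (hd : d = 2 ∨ d = 3)
    (h : ℕ → ℝ) (hh : ∀ n, h n ∈ Set.Ioo (0 : ℝ) 1)
    (hto : Tendsto h atTop (nhds 0))
    (hspec : ∀ n, ∀ l : ℕ, (h n) ^ (-2 : ℤ) ≠ lam2 d (l : ℤ))
    (L : ℕ → ℕ) (s : ℕ → ℝ) (hs : ∀ n, s n ∈ Set.Ico (0 : ℝ) 1)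
    (heq : ∀ n, (h n) ^ (-2 : ℤ) =
      ((L n : ℝ) + s n) * ((L n : ℝ) + s n + (d : ℝ) - 1))
    (β : ℕ → ℂ × ℂ) (βl : ℂ × ℂ) (hβ : Tendsto β atTop (nhds βl))
    (ρ : ℂ) (hρ : ∀ n, ρ = (-1 : ℂ) ^ (L n))
    (σ : ℝ) (hσ : σ ∈ Set.Ioo (0 : ℝ) 1) (hsto : Tendsto s atTop (nhds σ)) :
    ∃ C : ℝ, 1 < C ∧ ∀ Υ : ℕ, 1 ≤ Υ → ∃ ν : ℕ, ∀ n ≥ ν,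
      |(∑ k ∈ Finset.Icc (-(Υ : ℤ)) (Υ : ℤ),
          ‖(β n).1 + (-1 : ℂ) ^ ((L n : ℤ) + k) * (β n).2‖ ^ 2 *
            mult d ((L n : ℤ) + k) /
              (lam2 d ((L n : ℤ) + k) - (h n) ^ (-2 : ℤ)) ^ 2)
        - (∑' k : ℤ, ‖βl.1 + (-1 : ℂ) ^ k * ρ * βl.2‖ ^ 2 / ((k : ℝ) - σ) ^ 2)
            * (h n) ^ ((3 : ℤ) - (d : ℤ)) / (2 * ((d : ℝ) - 1))|
      ≤ C * (h n) ^ ((3 : ℤ) - (d : ℤ)) *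
          ((Υ : ℝ) * h n + |s n - σ| + ‖β n - βl‖ + (Υ : ℝ)⁻¹) := by
  obtain ⟨hσ0, hσ1⟩ := hσ
  obtain ⟨δ, hδ, hδσ, hδσ'⟩ : ∃ δ : ℝ, 0 < δ ∧ δ < σ ∧ σ < 1 - δ := by
    refine ⟨min σ (1 - σ) / 2, ?_, ?_, ?_⟩
    · have := lt_min hσ0 (sub_pos.2 hσ1); linarith
    · have := min_le_left σ (1 - σ); linarith
    · have := min_le_right σ (1 - σ); linarith
  have hδ1 : δ ≤ 1 := by linarith
  obtain ⟨B, hB⟩ : ∃ B : ℝ, B = ‖βl‖ + 1 := ⟨_, rfl⟩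
  have hB1 : 1 ≤ B := by linarith [norm_nonneg βl]
  have hρ1 : ‖ρ‖ = 1 := by rw [hρ 0]; simp
  have hε : ∀ k : ℤ, ‖(-1 : ℂ) ^ k * ρ‖ = 1 := fun k => by simp [hρ1]
  have hA₀ : ∀ k : ℤ, ‖βl.1 + (-1 : ℂ) ^ k * ρ * βl.2‖ ^ 2 ≤ 4 * B ^ 2 := fun k => by
    calc _ ≤ (2 * B) ^ 2 := by
          gcongr; exact (norm_add_unit_mul_le βl (hε k)).trans (by linarith)
      _ = _ := by ring
  have hF : ∀ k : ℤ, |‖βl.1 + (-1 : ℂ) ^ k * ρ * βl.2‖ ^ 2 / ((k : ℝ) - σ) ^ 2|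
      ≤ 8 * B ^ 2 / δ ^ 2 * (1 + (k : ℝ) ^ 2)⁻¹ := fun k => by
    rw [abs_of_nonneg (by positivity), div_eq_mul_inv]
    calc _ ≤ 4 * B ^ 2 * (2 / δ ^ 2 * (1 + (k : ℝ) ^ 2)⁻¹) := by
          gcongr
          · exact hA₀ k
          · exact (inv_int_sub_sq_le hδ hδσ.le hδσ'.le k).2
      _ = _ := by ring
  set F : ℤ → ℝ := fun k => ‖βl.1 + (-1 : ℂ) ^ k * ρ * βl.2‖ ^ 2 / ((k : ℝ) - σ) ^ 2 with hFd
  set W : ℝ := ∑' k : ℤ, (1 + (k : ℝ) ^ 2)⁻¹ with hW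
  have hW0 : 0 ≤ W := tsum_nonneg fun k => by positivity
  set K : ℝ := 48 * B ^ 2 / δ ^ 3 with hK
  have hK0 : 0 < K := by positivity
  refine ⟨1 + K * (W + 1), by nlinarith [mul_nonneg hK0.le hW0], fun Υ hΥ => ?_⟩
  have hΥ1 : (1 : ℝ) ≤ Υ := by exact_mod_cast hΥ
  have ev : ∀ᶠ n in atTop, 2 * (Υ : ℝ) * h n ≤ 1 ∧ δ ≤ s n ∧ s n ≤ 1 - δ ∧ ‖β n‖ ≤ B := by
    have t1 : Tendsto (fun n => 2 * (Υ : ℝ) * h n) atTop (nhds 0) := by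
      simpa using hto.const_mul (2 * (Υ : ℝ))
    filter_upwards [t1.eventually_le_const one_pos, hsto.eventually_const_le hδσ,
      hsto.eventually_le_const hδσ', hβ.norm.eventually_le_const (by linarith : ‖βl‖ < B)]
      with n a b c e using ⟨a, b, c, e⟩
  obtain ⟨ν, hν⟩ := eventually_atTop.1 ev
  refine ⟨ν, fun n hn => ?_⟩
  obtain ⟨hTh, hs1, hs2, hβB⟩ := hν n hn
  have hh0 := (hh n).1
  set H : ℝ := (h n) ^ ((3 : ℤ) - (d : ℤ)) with hH
  have hH0 : 0 < H := zpow_pos hh0 _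
  have hd2 : (2 : ℝ) ≤ 2 * ((d : ℝ) - 1) := by rcases hd with rfl | rfl <;> norm_num
  set R₀ : ℝ := H / (2 * ((d : ℝ) - 1)) with hR₀d
  have hR₀0 : 0 ≤ R₀ := by positivity
  have hR₀ : R₀ ≤ H / 2 := by rw [hR₀d]; gcongr
  have hterm : ∀ k ∈ Finset.Icc (-(Υ : ℤ)) (Υ : ℤ),
      |‖(β n).1 + (-1 : ℂ) ^ ((L n : ℤ) + k) * (β n).2‖ ^ 2 * mult d ((L n : ℤ) + k) /
          (lam2 d ((L n : ℤ) + k) - (h n) ^ (-2 : ℤ)) ^ 2 - F k * R₀|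
        ≤ K * H * (Υ * h n + |s n - σ| + ‖β n - βl‖) * (1 + (k : ℝ) ^ 2)⁻¹ := by
    intro k hk
    rw [Finset.mem_Icc] at hk
    have hk1 : -(Υ : ℝ) ≤ k := by exact_mod_cast hk.1
    have hk2 : (k : ℝ) ≤ Υ := by exact_mod_cast hk.2
    have hR := abs_mult_div_sub_le (l := (L n : ℤ)) (k := k) hd hh0
      (by have := (hs n).1; push_cast; positivity) (by exact_mod_cast heq n)
      (abs_le.2 ⟨by linarith, by linarith⟩ : |(k : ℝ) - s n| ≤ 2 * Υ) hΥ1 hTh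
    rw [← hH, ← hR₀d] at hR
    set R : ℝ := mult d ((L n : ℤ) + k) /
      (2 * (((L n : ℤ) : ℝ) + s n) + d - 1 + (k - s n)) ^ 2 with hRd
    have hRle : |R| ≤ 3 * H := by
      have h1 : 4 * (Υ : ℝ) * h n * H ≤ 2 * H := by gcongr; linarith
      rw [abs_le] at hR ⊢
      constructor <;> linarith
    have hgap : lam2 d ((L n : ℤ) + k) - (h n) ^ (-2 : ℤ) =
        (k - s n) * (2 * (((L n : ℤ) : ℝ) + s n) + d - 1 + (k - s n)) := by
      rw [heq n, lam2]; push_cast; ring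
    have hpow : (-1 : ℂ) ^ ((L n : ℤ) + k) = (-1 : ℂ) ^ k * ρ := by
      rw [zpow_add₀ (by norm_num), zpow_natCast, ← hρ n, mul_comm]
    obtain ⟨ha, ha'⟩ := inv_int_sub_sq_le hδ hs1 hs2 k
    obtain ⟨hb, hb'⟩ := inv_int_sub_sq_le hδ hδσ.le hδσ'.le k
    have huu := abs_inv_sq_sub_inv_sq_le hδ ha hb ha' hb'
    rw [show (k : ℝ) - s n - (k - σ) = -(s n - σ) by ring, abs_neg,
      show 2 / δ * (2 / δ ^ 2 * (1 + (k : ℝ) ^ 2)⁻¹) = 4 / δ ^ 3 * (1 + (k : ℝ) ^ 2)⁻¹ by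
        field_simp; norm_num] at huu
    have hA : |‖(β n).1 + (-1 : ℂ) ^ k * ρ * (β n).2‖ ^ 2
        - ‖βl.1 + (-1 : ℂ) ^ k * ρ * βl.2‖ ^ 2| ≤ 8 * ‖β n - βl‖ * B := by
      refine (abs_sq_norm_add_unit_mul_sub_le (β n) βl (hε k)).trans ?_
      nlinarith [norm_nonneg (β n - βl)]
    have := abs_mul_mul_sub_le hδ hδ1 hB1 hH0.le (norm_nonneg (β n - βl))
      (by positivity : 0 ≤ (Υ : ℝ) * h n) (abs_nonneg (s n - σ))
      (by positivity : 0 ≤ (1 + (k : ℝ) ^ 2)⁻¹) hA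
      (by rw [abs_of_nonneg (by positivity)]; exact hA₀ k) hRle (hR.trans_eq (by ring))
      (by rwa [abs_of_nonneg hR₀0]) (by rwa [abs_of_nonneg (by positivity)]) huu
    rw [hpow, hgap]
    convert this using 2
    rw [hRd, hFd]
    simp only [div_eq_mul_inv, mul_pow, mul_inv]
    ring
  have htail := abs_sum_Icc_sub_tsum_le hF hΥ
  have hfin : |(∑ k ∈ Finset.Icc (-(Υ : ℤ)) (Υ : ℤ),
      ‖(β n).1 + (-1 : ℂ) ^ ((L n : ℤ) + k) * (β n).2‖ ^ 2 * mult d ((L n : ℤ) + k) /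
        (lam2 d ((L n : ℤ) + k) - (h n) ^ (-2 : ℤ)) ^ 2)
      - (∑ k ∈ Finset.Icc (-(Υ : ℤ)) (Υ : ℤ), F k) * R₀|
      ≤ K * H * (Υ * h n + |s n - σ| + ‖β n - βl‖) * W := by
    rw [Finset.sum_mul, ← Finset.sum_sub_distrib]
    refine (Finset.abs_sum_le_sum_abs _ _).trans ((Finset.sum_le_sum hterm).trans ?_)
    rw [← Finset.mul_sum]
    gcongr
    exact summable_int_inv_one_add_sq.sum_le_tsum _ fun k _ => by positivity
  have htail' : |(∑ k ∈ Finset.Icc (-(Υ : ℤ)) (Υ : ℤ), F k) * R₀ - (∑' k, F k) * R₀|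
      ≤ K * H * (Υ : ℝ)⁻¹ := by
    rw [← sub_mul, abs_mul, abs_of_nonneg hR₀0]
    have h1 : 8 * B ^ 2 / δ ^ 2 ≤ K := by
      rw [hK]
      gcongr ?_ / ?_
      · nlinarith
      · exact pow_le_pow_of_le_one hδ.le hδ1 (by norm_num)
    calc _ ≤ 2 * (8 * B ^ 2 / δ ^ 2) * (Υ : ℝ)⁻¹ * (H / 2) := by gcongr
      _ = (8 * B ^ 2 / δ ^ 2) * H * (Υ : ℝ)⁻¹ := by ring
      _ ≤ _ := by gcongr
  rw [mul_div_assoc, ← hR₀d]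
  refine (abs_sub_le _ _ _).trans ((add_le_add hfin htail').trans ?_)
  set E : ℝ := Υ * h n + |s n - σ| + ‖β n - βl‖ with hE
  have hE0 : 0 ≤ E := by positivity
  have hi : 0 ≤ (Υ : ℝ)⁻¹ := by positivity
  have : (1 + K * (W + 1)) * H * (E + (Υ : ℝ)⁻¹) - (K * H * E * W + K * H * (Υ : ℝ)⁻¹)
      = H * (E + (Υ : ℝ)⁻¹) + K * H * E + K * H * W * (Υ : ℝ)⁻¹ := by ring
  have : 0 ≤ H * (E + (Υ : ℝ)⁻¹) + K * H * E + K * H * W * (Υ : ℝ)⁻¹ := by positivity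
  linarith
end

section
/- For every σ ∈ (0,1), every ρ ∈ {−1, +1} and every β = (β₊, β₋) ∈ ℂ², the series Σ_{k∈ℤ} |β₊ + (−1)^k ρ β₋|²/(k−σ)² converges and equals (2π)²/|1 − e^{2πiσ}|² · ( (1/2)|β₊ + ρ β₋ e^{iπσ}|² + (1/2)|β₊ + ρ β₋ e^{−iπσ}|² ). -/
open MeasureTheory in
/-- The partial fraction expansion of `π² / sin² (π s)`. -/
theorem hasSum_one_div_int_sub_sq {s : ℝ} (hs : ∀ n : ℤ, (n : ℝ) ≠ s) :
    HasSum (fun n : ℤ => 1 / ((n : ℝ) - s) ^ 2)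
      (Real.pi ^ 2 / Real.sin (Real.pi * s) ^ 2) := by
  have hπ : Real.pi ≠ 0 := Real.pi_ne_zero
  have hsin : Real.sin (Real.pi * s) ≠ 0 := by
    intro h
    obtain ⟨n, hn⟩ := Real.sin_eq_zero_iff.mp h
    exact hs n (mul_left_cancel₀ hπ (by linarith))
  let f : ℝ → ℂ := fun x => Complex.exp (2 * Real.pi * Complex.I * s * x)
  have hf_norm (x : ℝ) : ‖f x‖ = 1 := by
    have : (2 * Real.pi * Complex.I * s * x : ℂ) = (2 * Real.pi * s * x : ℝ) * Complex.I := by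
      push_cast
      ring
    simp only [f]
    rw [this, Complex.norm_exp_ofReal_mul_I]
  have hf_memLp : MemLp f 2 (volume.restrict (Set.Ioc 0 1)) :=
    MemLp.of_bound (by fun_prop) 1 (.of_forall fun x => (hf_norm x).le)
  have hcoeff (n : ℤ) : ‖fourierCoeffOn zero_lt_one f n‖ ^ 2 =
      Real.sin (Real.pi * s) ^ 2 / Real.pi ^ 2 * (1 / ((n : ℝ) - s) ^ 2) := by
    have hns : (s : ℝ) - n ≠ 0 := sub_ne_zero.mpr (hs n).symm
    let c : ℂ := Complex.I * (2 * Real.pi * (s - n) : ℝ)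
    have hc : c ≠ 0 := mul_ne_zero Complex.I_ne_zero
      (Complex.ofReal_ne_zero.mpr (mul_ne_zero (by positivity) hns))
    have hint : fourierCoeffOn zero_lt_one f n = (Complex.exp c - 1) / c := by
      have h := integral_exp_mul_complex (a := 0) (b := 1) hc
      simp only [Complex.ofReal_one, Complex.ofReal_zero, mul_one, mul_zero, Complex.exp_zero] at h
      rw [fourierCoeffOn_eq_integral, ← h]
      simp only [sub_zero, div_one, one_smul]
      refine intervalIntegral.integral_congr fun x _ => ?_
      simp only [fourier_coe_apply, smul_eq_mul, f, ← Complex.exp_add, c]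
      congr 1
      push_cast
      ring
    have hsin_sub : Real.sin (2 * Real.pi * (s - n) / 2) ^ 2 = Real.sin (Real.pi * s) ^ 2 := by
      rw [show 2 * Real.pi * (s - n) / 2 = Real.pi * s - n * Real.pi by ring,
        Real.sin_sub_int_mul_pi, mul_pow]
      rcases Int.even_or_odd n with h | h <;> simp [h.neg_one_zpow]
    rw [hint, norm_div, Complex.norm_exp_I_mul_ofReal_sub_one, div_pow, Real.norm_eq_abs, sq_abs,
      norm_mul, Complex.norm_I, Complex.norm_real, Real.norm_eq_abs, one_mul, sq_abs, mul_pow,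
      hsin_sub]
    have hsn : (n : ℝ) - s ≠ 0 := sub_ne_zero.mpr (hs n)
    field_simp
    ring
  have h := hasSum_sq_fourierCoeffOn zero_lt_one hf_memLp
  simp only [hcoeff, hf_norm] at h
  convert! h.mul_left (Real.pi ^ 2 / Real.sin (Real.pi * s) ^ 2) using 1
  · ext n
    rw [← mul_assoc, div_mul_div_cancel₀ (pow_ne_zero 2 hsin), div_self (pow_ne_zero 2 hπ), one_mul]
  · simp

/-- A sum over the integers splits into its even and odd parts. -/
theorem HasSum.int_even_add_odd {M : Type*} [AddCommMonoid M] [TopologicalSpace M]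
    [ContinuousAdd M] {f : ℤ → M} {a b : M} (ha : HasSum (fun n : ℤ => f (2 * n)) a)
    (hb : HasSum (fun n : ℤ => f (2 * n + 1)) b) : HasSum f (a + b) := by
  have h2 : Function.Injective (fun n : ℤ => 2 * n) := fun m n h => by simpa using h
  have h21 : Function.Injective (fun n : ℤ => 2 * n + 1) := fun m n h => by simpa using h
  refine HasSum.add_isCompl ?_ (h2.hasSum_range_iff.mpr ha) (h21.hasSum_range_iff.mpr hb)
  convert! Int.isCompl_even_odd using 1
  · ext n
    simp [even_iff_exists_two_mul]
  · ext n
    simp [Odd]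

theorem norm_one_sub_exp_two_mul_sq (x : ℝ) :
    ‖1 - Complex.exp (((2 * x : ℝ) : ℂ) * Complex.I)‖ ^ 2 = 4 * Real.sin x ^ 2 := by
  rw [norm_sub_rev, mul_comm _ Complex.I, Complex.norm_exp_I_mul_ofReal_sub_one,
    Real.norm_eq_abs, sq_abs, mul_div_cancel_left₀ x two_ne_zero]
  ring

/-- The parallelogram-type identity for the average over the phases `± 2 x`. -/
theorem half_norm_add_exp_sq_add_half_norm_add_exp_neg_sq (a b : ℂ) (x : ℝ) :
    1 / 2 * ‖a + b * Complex.exp (((2 * x : ℝ) : ℂ) * Complex.I)‖ ^ 2 +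
      1 / 2 * ‖a + b * Complex.exp (-(((2 * x : ℝ) : ℂ) * Complex.I))‖ ^ 2 =
    ‖a + b‖ ^ 2 * Real.cos x ^ 2 + ‖a - b‖ ^ 2 * Real.sin x ^ 2 := by
  rw [← neg_mul, ← Complex.ofReal_neg]
  simp only [Complex.sq_norm, Complex.normSq_apply, Complex.add_re, Complex.add_im,
    Complex.sub_re, Complex.sub_im, Complex.mul_re, Complex.mul_im,
    Complex.exp_ofReal_mul_I_re, Complex.exp_ofReal_mul_I_im, Real.cos_neg, Real.sin_neg,
    Real.cos_two_mul', Real.sin_two_mul]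
  have h := Real.sin_sq_add_cos_sq x
  generalize Real.sin x = s at *
  generalize Real.cos x = c at *
  have hs : s ^ 2 = 1 - c ^ 2 := by linarith
  have hs4 : s ^ 4 = (1 - c ^ 2) ^ 2 := by rw [← hs]; ring
  ring_nf
  simp only [hs, hs4]
  ring


/-- For `σ ∈ (0,1)`, `ρ ∈ {−1,+1}` and `β = (β₊,β₋) ∈ ℂ²`, the series
`Σ_{k∈ℤ} |β₊ + (−1)^k ρ β₋|²/(k−σ)²` converges and equals
`(2π)²/|1 − e^{2πiσ}|² · ((1/2)|β₊ + ρ β₋ e^{iπσ}|² + (1/2)|β₊ + ρ β₋ e^{−iπσ}|²)`. -/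
theorem stmt_10 (σ : ℝ) (hσ : σ ∈ Set.Ioo (0 : ℝ) 1)
    (ρ : ℂ) (hρ : ρ = 1 ∨ ρ = -1) (βp βm : ℂ) :
    Summable (fun k : ℤ => ‖βp + (-1 : ℂ) ^ k * ρ * βm‖ ^ 2 / ((k : ℝ) - σ) ^ 2) ∧
    (∑' k : ℤ, ‖βp + (-1 : ℂ) ^ k * ρ * βm‖ ^ 2 / ((k : ℝ) - σ) ^ 2)
      = (2 * Real.pi) ^ 2 /
          ‖1 - Complex.exp (((2 * Real.pi * σ : ℝ) : ℂ) * Complex.I)‖ ^ 2 *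
        (1 / 2 * ‖βp + ρ * βm * Complex.exp (((Real.pi * σ : ℝ) : ℂ) * Complex.I)‖ ^ 2
          + 1 / 2 *
            ‖βp + ρ * βm * Complex.exp (-(((Real.pi * σ : ℝ) : ℂ) * Complex.I))‖ ^ 2) := by
  obtain ⟨h0, h1⟩ := hσ
  have hπ := Real.pi_pos
  let x := Real.pi * σ / 2
  have hsin : Real.sin x ≠ 0 :=
    (Real.sin_pos_of_pos_of_lt_pi (by positivity) (by simp only [x]; nlinarith)).ne'
  have hcos : Real.cos x ≠ 0 :=
    (Real.cos_pos_of_mem_Ioo ⟨by simp only [x]; nlinarith, by simp only [x]; nlinarith⟩).ne'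
  have heven := hasSum_one_div_int_sub_sq (s := σ / 2) fun n hn => by
    have h2 : (0 : ℝ) < n := by linarith
    have h3 : (n : ℝ) < 1 := by linarith
    norm_cast at h2 h3
    lia
  have hodd := hasSum_one_div_int_sub_sq (s := (σ - 1) / 2) fun n hn => by
    have h2 : (-1 : ℝ) < n := by linarith
    have h3 : (n : ℝ) < 0 := by linarith
    norm_cast at h2 h3
    lia
  rw [show Real.pi * (σ / 2) = x by simp only [x]; ring] at heven
  rw [show Real.pi * ((σ - 1) / 2) = x - Real.pi / 2 by simp only [x]; ring,
    Real.sin_sub_pi_div_two, neg_sq] at hodd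
  have key : HasSum (fun k : ℤ => ‖βp + (-1 : ℂ) ^ k * ρ * βm‖ ^ 2 / ((k : ℝ) - σ) ^ 2)
      (‖βp + ρ * βm‖ ^ 2 / 4 * (Real.pi ^ 2 / Real.sin x ^ 2) +
        ‖βp - ρ * βm‖ ^ 2 / 4 * (Real.pi ^ 2 / Real.cos x ^ 2)) := by
    refine HasSum.int_even_add_odd ?_ ?_
    · convert! heven.mul_left (‖βp + ρ * βm‖ ^ 2 / 4) using 2 with n
      rw [(even_two_mul n).neg_one_zpow, one_mul, div_mul_div_comm, mul_one]
      congr 1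
      push_cast
      ring
    · convert! hodd.mul_left (‖βp - ρ * βm‖ ^ 2 / 4) using 2 with n
      rw [(odd_two_mul_add_one n).neg_one_zpow, neg_one_mul, neg_mul, ← sub_eq_add_neg,
        div_mul_div_comm, mul_one]
      congr 1
      push_cast
      ring
  refine ⟨key.summable, key.tsum_eq.trans ?_⟩
  rw [mul_assoc 2 Real.pi σ, norm_one_sub_exp_two_mul_sq,
    show Real.pi * σ = 2 * x by simp only [x]; ring,
    half_norm_add_exp_sq_add_half_norm_add_exp_neg_sq, Real.sin_two_mul]
  field_simp
end

section
/- For every α > 0 and every δ ∈ (0, π/2) there exist C > 0 and L ∈ ℕ such that for all integers ℓ ≥ L and all θ ∈ [δ, π−δ]: |C_ℓ^{(α)}(cos θ) − (2^{1−α}/Γ(α)) ℓ^{α−1} (sin θ)^{−α} cos((ℓ+α)θ − απ/2)| ≤ C ℓ^{α−2}. In particular, for every α > 0 and δ ∈ (0, π/2) there exists C > 0 such that |C_ℓ^{(α)}(cos θ)| ≤ C ℓ^{α−1} for all ℓ ≥ 1 and all θ ∈ [δ, π−δ]. -/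
/-- The Gegenbauer (ultraspherical) polynomial `C_ℓ^{(α)}`, as a function of `s`, defined
through Bonnet's recursion `(ℓ+1)C_{ℓ+1}(s) = 2(ℓ+α)s C_ℓ(s) − (ℓ+2α−1)C_{ℓ−1}(s)`
with `C₀ = 1`, `C₁(s) = 2αs`; this is the coefficient sequence of the generating
function `(1 − 2sx + x²)^{−α} = Σ_ℓ C_ℓ^{(α)}(s) x^ℓ`. -/
noncomputable def gegenbauer (α : ℝ) : ℕ → ℝ → ℝ
  | 0 => fun _ => 1
  | 1 => fun s => 2 * α * s
  | (n + 2) => fun s =>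
      (2 * ((n : ℝ) + 1 + α) * s * gegenbauer α (n + 1) s
        - ((n : ℝ) + 2 * α) * gegenbauer α n s) / ((n : ℝ) + 2)

open Filter Topology

theorem succ_mul_multichoose_succ (α : ℝ) (n : ℕ) :
    ((n : ℝ) + 1) * Ring.multichoose α (n + 1) = (α + n) * Ring.multichoose α n := by
  have h1 := Ring.factorial_nsmul_multichoose_eq_ascPochhammer α (n + 1)
  have h0 := Ring.factorial_nsmul_multichoose_eq_ascPochhammer α n
  rw [Polynomial.ascPochhammer_smeval_eq_eval, nsmul_eq_mul] at h0 h1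
  rw [ascPochhammer_succ_eval, ← h0, Nat.factorial_succ] at h1
  have : (n.factorial : ℝ) ≠ 0 := by positivity
  push_cast at h1
  apply mul_left_cancel₀ this
  linear_combination h1

theorem multichoose_pos {α : ℝ} (hα : 0 < α) (n : ℕ) : 0 < Ring.multichoose α n := by
  induction n with
  | zero => simp
  | succ n ih =>
    have h := succ_mul_multichoose_succ α n
    have : 0 < (α + n) * Ring.multichoose α n := by positivity
    rw [← h] at this
    exact (pos_iff_pos_of_mul_pos this).1 (by positivity)

theorem mul_multichoose_add_one (α : ℝ) (n : ℕ) :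
    α * Ring.multichoose (α + 1) n = (α + n) * Ring.multichoose α n := by
  induction n with
  | zero => simp
  | succ n ih =>
    have h := succ_mul_multichoose_succ α n
    have h' := succ_mul_multichoose_succ (α + 1) n
    have : (n : ℝ) + 1 ≠ 0 := by positivity
    apply mul_left_cancel₀ this
    push_cast
    linear_combination α * h' + (α + 1 + n) * ih - (α + n + 1) * h

theorem multichoose_mul_Gamma {α : ℝ} (hα : 0 < α) (n : ℕ) :
    Ring.multichoose α n * (Real.Gamma α * Real.Gamma (n + 1)) = Real.Gamma (n + α) := by
  induction n with
  | zero => simp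
  | succ n ih =>
    have h := succ_mul_multichoose_succ α n
    have e1 : Real.Gamma ((n + 1 : ℕ) + 1) = (n + 1) * Real.Gamma (n + 1) := by
      push_cast; exact Real.Gamma_add_one (by positivity)
    have e2 : Real.Gamma ((n + 1 : ℕ) + α) = (n + α) * Real.Gamma (n + α) := by
      rw [← Real.Gamma_add_one (by positivity)]; push_cast; ring_nf
    rw [e1, e2, ← ih]
    linear_combination (Real.Gamma α * Real.Gamma (n + 1)) * h

/-- Gautschi inequalities for the ratio `Γ(n + α) / Γ(n + 1)`. -/
theorem Gamma_add_le_rpow_mul_Gamma {α : ℝ} (hα : 0 < α) (hα1 : α < 1) {x : ℝ} (hx : 0 < x) :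
    Real.Gamma (x + α) ≤ x ^ (α - 1) * Real.Gamma (x + 1) := by
  have h := Real.Gamma_mul_add_mul_le_rpow_Gamma_mul_rpow_Gamma hx (by positivity : 0 < x + 1)
    (sub_pos.2 hα1) hα (by ring)
  have hG := Real.Gamma_pos_of_pos hx
  have e : (1 - α) * x + α * (x + 1) = x + α := by ring
  rw [e, Real.Gamma_add_one hx.ne', Real.mul_rpow hx.le hG.le] at h
  rw [Real.Gamma_add_one hx.ne']
  calc _ ≤ _ := h
    _ = x ^ α * (Real.Gamma x ^ (1 - α) * Real.Gamma x ^ α) := by ring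
    _ = x ^ α * Real.Gamma x := by
      rw [← Real.rpow_add hG, sub_add_cancel, Real.rpow_one]
    _ = _ := by rw [Real.rpow_sub_one hx.ne']; field_simp

theorem rpow_mul_Gamma_le_Gamma_add {α : ℝ} (hα : 0 < α) (hα1 : α < 1) {x : ℝ} (hx : 0 < x) :
    (x + α) ^ (α - 1) * Real.Gamma (x + 1) ≤ Real.Gamma (x + α) := by
  have h := Gamma_add_le_rpow_mul_Gamma (sub_pos.2 hα1) (by linarith) (by positivity : 0 < x + α)
  have e : x + α + (1 - α) = x + 1 := by ring
  have hp : 0 < x + α := by positivity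
  rw [e, Real.Gamma_add_one hp.ne', show 1 - α - 1 = -α by ring] at h
  calc _ ≤ _ := mul_le_mul_of_nonneg_left h (by positivity)
    _ = Real.Gamma (x + α) := by
      rw [Real.rpow_sub_one hp.ne', Real.rpow_neg hp.le]
      have := Real.rpow_pos_of_pos hp α
      field_simp

theorem abs_multichoose_sub_le_of_lt_one {α : ℝ} (hα : 0 < α) (hα1 : α < 1) {n : ℕ} (hn : 1 ≤ n) :
    |Ring.multichoose α n - (n : ℝ) ^ (α - 1) / Real.Gamma α|
      ≤ α / Real.Gamma α * (n : ℝ) ^ (α - 2) := by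
  have hn0 : (0 : ℝ) < n := by exact_mod_cast hn
  have hG := Real.Gamma_pos_of_pos hα
  have hG1 : 0 < Real.Gamma ((n : ℝ) + 1) := Real.Gamma_pos_of_pos (by positivity)
  have h1 := Gamma_add_le_rpow_mul_Gamma hα hα1 hn0
  have h2 := rpow_mul_Gamma_le_Gamma_add hα hα1 hn0
  rw [← multichoose_mul_Gamma hα n, ← mul_assoc] at h1 h2
  replace h1 := le_of_mul_le_mul_right h1 hG1
  replace h2 := le_of_mul_le_mul_right h2 hG1
  have h3 : (n : ℝ) ^ (α - 1) - α * (n : ℝ) ^ (α - 2) ≤ (n + α) ^ (α - 1) := by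
    have hp : (0 : ℝ) < n + α := by positivity
    have hle : (n : ℝ) ^ α ≤ (n + α) ^ α := by gcongr; linarith
    have hna := Real.rpow_pos_of_pos hn0 α
    rw [Real.rpow_sub_one hn0.ne', Real.rpow_sub_one hp.ne', show α - 2 = α - 1 - 1 by ring,
      Real.rpow_sub_one hn0.ne', Real.rpow_sub_one hn0.ne']
    calc _ = (n : ℝ) ^ α * ((n - α) / (n * n)) := by field_simp
      _ ≤ (n : ℝ) ^ α * (1 / (n + α)) := by
        refine mul_le_mul_of_nonneg_left ?_ hna.le
        rw [div_le_div_iff₀ (by positivity) hp]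
        nlinarith [sq_nonneg α]
      _ ≤ (n + α) ^ α * (1 / (n + α)) := by gcongr
      _ = _ := by ring
  have : Ring.multichoose α n - (n : ℝ) ^ (α - 1) / Real.Gamma α
      = (Ring.multichoose α n * Real.Gamma α - (n : ℝ) ^ (α - 1)) / Real.Gamma α := by
    field_simp
  rw [this, abs_div, abs_of_pos hG, div_mul_eq_mul_div]
  gcongr
  have : 0 < (n : ℝ) ^ (α - 2) := by positivity
  rw [abs_le]
  constructor <;> nlinarith

theorem exists_abs_multichoose_sub_le {α : ℝ} (hα : 0 < α) :
    ∃ C : ℝ, 0 < C ∧ ∀ n : ℕ, 1 ≤ n →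
      |Ring.multichoose α n - (n : ℝ) ^ (α - 1) / Real.Gamma α| ≤ C * (n : ℝ) ^ (α - 2) := by
  have key : ∀ k : ℕ, ∀ α : ℝ, 0 < α → α ≤ k + 1 → ∃ C : ℝ, 0 < C ∧ ∀ n : ℕ, 1 ≤ n →
      |Ring.multichoose α n - (n : ℝ) ^ (α - 1) / Real.Gamma α| ≤ C * (n : ℝ) ^ (α - 2) := by
    intro k
    induction k with
    | zero =>
      intro α hα hα1
      have hG := Real.Gamma_pos_of_pos hα
      refine ⟨α / Real.Gamma α, by positivity, fun n hn => ?_⟩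
      rcases lt_or_eq_of_le hα1 with h | h
      · exact abs_multichoose_sub_le_of_lt_one hα (by simpa using h) hn
      · have h : α = 1 := by simpa using h
        subst h
        have := multichoose_mul_Gamma one_pos n
        have hG1 : Real.Gamma ((n : ℝ) + 1) ≠ 0 := (Real.Gamma_pos_of_pos (by positivity)).ne'
        rw [Real.Gamma_one, one_mul] at this
        rw [(mul_eq_right₀ hG1).1 this]
        simp
        positivity
    | succ k ih =>
      intro α hα hαk
      rcases le_or_gt α 1 with h1 | h1
      · exact ih α hα (by have : (0 : ℝ) ≤ k := by positivity
                          linarith)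
      · obtain ⟨β, rfl⟩ : ∃ β, α = β + 1 := ⟨α - 1, by ring⟩
        have hβ : 0 < β := by linarith
        obtain ⟨C, hC, h⟩ := ih β hβ (by push_cast at hαk; linarith)
        have hG := Real.Gamma_pos_of_pos hβ
        refine ⟨(C * (β + 1) + β / Real.Gamma β) / β, by positivity, fun n hn => ?_⟩
        have hn1 : (1 : ℝ) ≤ n := by exact_mod_cast hn
        have hn0 : (0 : ℝ) < n := by linarith
        have e := mul_multichoose_add_one β n
        rw [Real.Gamma_add_one hβ.ne', show β + 1 - 1 = β by ring, show β + 1 - 2 = β - 1 by ring]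
        have e1 : (n : ℝ) ^ β = n ^ (β - 1) * n := by rw [Real.rpow_sub_one hn0.ne']; field_simp
        have e2 : (n : ℝ) ^ (β - 1) = n ^ (β - 2) * n := by
          rw [show β - 2 = β - 1 - 1 by ring, Real.rpow_sub_one hn0.ne' (β - 1)]; field_simp
        have e3 : Ring.multichoose (β + 1) n - (n : ℝ) ^ β / (β * Real.Gamma β)
            = ((β + n) * (Ring.multichoose β n - (n : ℝ) ^ (β - 1) / Real.Gamma β)
              + β / Real.Gamma β * (n : ℝ) ^ (β - 1)) / β := by
          rw [eq_div_iff hβ.ne', e1]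
          field_simp
          linear_combination Real.Gamma β * e
        rw [e3, abs_div, abs_of_pos hβ, div_le_iff₀ hβ]
        have hp : 0 < (n : ℝ) ^ (β - 2) := by positivity
        calc _ ≤ |(β + n) * (Ring.multichoose β n - (n : ℝ) ^ (β - 1) / Real.Gamma β)|
              + |β / Real.Gamma β * (n : ℝ) ^ (β - 1)| := abs_add_le _ _
          _ ≤ ((β + 1) * n) * (C * (n : ℝ) ^ (β - 2)) + β / Real.Gamma β * (n : ℝ) ^ (β - 1) := by
            rw [abs_mul, abs_of_pos (by positivity : 0 < β + n),
              abs_of_nonneg (by positivity : 0 ≤ β / Real.Gamma β * (n : ℝ) ^ (β - 1))]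
            gcongr
            · nlinarith
            · exact h n hn
          _ = _ := by rw [e2]; field_simp
  exact key ⌈α⌉₊ α hα (by linarith [Nat.le_ceil α])

theorem hasSum_multichoose_mul_pow (α : ℝ) {z : ℂ} (hz : ‖z‖ < 1) :
    HasSum (fun n => ((Ring.multichoose α n : ℝ) : ℂ) * z ^ n) (1 / (1 - z) ^ (α : ℂ)) := by
  have h := (Complex.one_div_one_sub_cpow_hasFPowerSeriesOnBall_zero α).hasSum
    (y := z) (by simpa [enorm_eq_nnnorm] using! hz)
  simp only [zero_add, FormalMultilinearSeries.ofScalars_apply_eq, smul_eq_mul] at h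
  have e : (fun n : ℕ => ((Ring.multichoose α n : ℝ) : ℂ) * z ^ n)
      = fun n : ℕ => Ring.choose ((α : ℂ) + n - 1) n * z ^ n := by
    funext n
    rw [Ring.multichoose_eq, Complex.ofReal_choose]
    push_cast
    rfl
  rwa [e]

/-- The `n`-th coefficient of `(1 - x)^{-α} (1 - w x)^{-β}`. -/
noncomputable def binomialConv (α β : ℝ) (w : ℂ) (n : ℕ) : ℂ :=
  ∑ p ∈ Finset.HasAntidiagonal.antidiagonal n,
    ((Ring.multichoose α p.1 : ℝ) : ℂ) * (((Ring.multichoose β p.2 : ℝ) : ℂ) * w ^ p.2)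

/-- The formal power series of `(1 - w x)^{-α}`. -/
noncomputable def invBinomialSeries (α : ℝ) (w : ℂ) : PowerSeries ℂ :=
  PowerSeries.mk fun n => ((Ring.multichoose α n : ℝ) : ℂ) * w ^ n

theorem coeff_invBinomialSeries_mul (α β : ℝ) (w : ℂ) (n : ℕ) :
    PowerSeries.coeff n (invBinomialSeries α 1 * invBinomialSeries β w)
      = binomialConv α β w n := by
  simp [PowerSeries.coeff_mul, invBinomialSeries, binomialConv]

theorem hasSum_binomialConv (α β : ℝ) {w z : ℂ} (hw : ‖w‖ = 1) (hz : ‖z‖ < 1) :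
    HasSum (fun n => binomialConv α β w n * z ^ n)
      (1 / (1 - z) ^ (α : ℂ) * (1 / (1 - w * z) ^ (β : ℂ))) := by
  have hwz : ‖w * z‖ < 1 := by rwa [norm_mul, hw, one_mul]
  have h1 := hasSum_multichoose_mul_pow α hz
  have h2 := hasSum_multichoose_mul_pow β hwz
  have s1 := h1.summable.norm
  have s2 := h2.summable.norm
  have h := summable_norm_sum_mul_antidiagonal_of_summable_norm s1 s2
  have e := tsum_mul_tsum_eq_tsum_sum_antidiagonal_of_summable_norm s1 s2
  rw [h1.tsum_eq, h2.tsum_eq] at e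
  have es : (fun n => binomialConv α β w n * z ^ n)
      = fun n => ∑ p ∈ Finset.HasAntidiagonal.antidiagonal n,
        ((Ring.multichoose α p.1 : ℝ) : ℂ) * z ^ p.1
          * (((Ring.multichoose β p.2 : ℝ) : ℂ) * (w * z) ^ p.2) := by
    funext n
    rw [binomialConv, Finset.sum_mul]
    refine Finset.sum_congr rfl fun p hp => ?_
    rw [← Finset.HasAntidiagonal.mem_antidiagonal.1 hp, mul_pow, pow_add]
    ring
  rw [e, es]
  exact h.of_norm.hasSum

theorem derivative_invBinomialSeries (α : ℝ) (w : ℂ) :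
    (1 - PowerSeries.C w * PowerSeries.X) * PowerSeries.derivative ℂ (invBinomialSeries α w)
      = PowerSeries.C (α * w) * invBinomialSeries α w := by
  ext n
  rw [sub_mul, one_mul, mul_assoc, map_sub, PowerSeries.coeff_C_mul, PowerSeries.coeff_C_mul,
    PowerSeries.coeff_derivative]
  cases n with
  | zero => simp [invBinomialSeries]
  | succ n =>
    rw [PowerSeries.coeff_succ_X_mul, PowerSeries.coeff_derivative]
    have h := congrArg (fun x : ℝ => (x : ℂ)) (succ_mul_multichoose_succ α (n + 1))
    push_cast at h
    simp only [invBinomialSeries, PowerSeries.coeff_mk]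
    push_cast
    linear_combination w ^ (n + 2) * h

theorem binomialConv_self_rec (α : ℝ) (w : ℂ) (n : ℕ) :
    ((n : ℂ) + 2) * binomialConv α α w (n + 2)
      = (n + 1 + α) * (1 + w) * binomialConv α α w (n + 1)
        - (n + 2 * α) * w * binomialConv α α w n := by
  have hf := derivative_invBinomialSeries α 1
  have hg := derivative_invBinomialSeries α w
  set f := invBinomialSeries α 1
  set g := invBinomialSeries α w
  have hc : ∀ n, binomialConv α α w n = PowerSeries.coeff n (f * g) := fun n =>
    (coeff_invBinomialSeries_mul α α w n).symm
  set D := PowerSeries.derivative ℂ (f * g) with hD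
  have hD' : D = f * PowerSeries.derivative ℂ g + g * PowerSeries.derivative ℂ f := by
    rw [hD, Derivation.leibniz, smul_eq_mul, smul_eq_mul]
  have key : D - PowerSeries.C (1 + w) * (PowerSeries.X * D)
      + PowerSeries.C w * (PowerSeries.X * (PowerSeries.X * D))
      = PowerSeries.C (α * (1 + w)) * (f * g)
        - PowerSeries.C (2 * α * w) * (PowerSeries.X * (f * g)) := by
    simp only [map_mul, map_add, map_one, mul_one, one_mul, map_ofNat] at hf hg ⊢
    rw [hD']
    linear_combination (1 - PowerSeries.X) * f * hg
      + (1 - PowerSeries.C w * PowerSeries.X) * g * hf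
  have := congrArg (PowerSeries.coeff (n + 1)) key
  rw [map_add, map_sub, map_sub] at this
  simp only [PowerSeries.coeff_C_mul, PowerSeries.coeff_succ_X_mul] at this
  rw [hD, PowerSeries.coeff_derivative, PowerSeries.coeff_derivative, ← hc, ← hc, ← hc] at this
  cases n with
  | zero =>
    simp at this ⊢
    linear_combination this
  | succ n =>
    rw [PowerSeries.coeff_succ_X_mul, PowerSeries.coeff_derivative, ← hc] at this
    push_cast at this ⊢
    linear_combination this

theorem binomialConv_sub_one_succ (α : ℝ) (w : ℂ) (n : ℕ) :
    binomialConv α (α - 1) w (n + 1)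
      = binomialConv α α w (n + 1) - w * binomialConv α α w n := by
  have h : invBinomialSeries (α - 1) w
      = invBinomialSeries α w - PowerSeries.C w * (PowerSeries.X * invBinomialSeries α w) := by
    ext n
    rw [map_sub, PowerSeries.coeff_C_mul]
    cases n with
    | zero => simp [invBinomialSeries]
    | succ n =>
      rw [PowerSeries.coeff_succ_X_mul]
      have h := Ring.multichoose_succ_succ (α - 1) n
      rw [sub_add_cancel] at h
      simp only [invBinomialSeries, PowerSeries.coeff_mk, h]
      push_cast
      ring
  rw [← coeff_invBinomialSeries_mul, ← coeff_invBinomialSeries_mul, ← coeff_invBinomialSeries_mul,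
    h, mul_sub, map_sub, mul_left_comm, PowerSeries.coeff_C_mul, mul_left_comm,
    PowerSeries.coeff_succ_X_mul]

theorem binomialConv_zero (α β : ℝ) (w : ℂ) : binomialConv α β w 0 = 1 := by
  simp [binomialConv]

theorem binomialConv_one (α β : ℝ) (w : ℂ) : binomialConv α β w 1 = α + β * w := by
  simp [binomialConv, Finset.Nat.antidiagonal_succ, add_comm]

theorem exists_limit_of_norm_sub_le {H : ℕ → ℂ} {K : ℝ}
    (h : ∀ n : ℕ, ‖H (n + 1) - H n‖ ≤ K / ((n : ℝ) + 1) ^ 2) :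
    ∃ L : ℂ, ∀ n : ℕ, 1 ≤ n → ‖H n - L‖ ≤ K / n := by
  have hK : 0 ≤ K := by have := (norm_nonneg _).trans (h 0); simpa using this
  have key : ∀ n : ℕ, 1 ≤ n → ∀ k : ℕ, ‖H (n + k) - H n‖ ≤ K * (1 / n - 1 / (n + k : ℕ)) := by
    intro n hn k
    have hn0 : (0 : ℝ) < n := by exact_mod_cast hn
    induction k with
    | zero => simp
    | succ k ih =>
      have h1 := h (n + k)
      have h2 : K / (((n + k : ℕ) : ℝ) + 1) ^ 2
          ≤ K * (1 / (n + k : ℕ) - 1 / (n + (k + 1) : ℕ)) := by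
        rw [div_eq_mul_one_div]
        refine mul_le_mul_of_nonneg_left ?_ hK
        push_cast
        rw [div_sub_div _ _ (by positivity) (by positivity),
          div_le_div_iff₀ (by positivity) (by positivity)]
        have : (0 : ℝ) < n + k := by positivity
        nlinarith
      calc _ = ‖(H (n + k + 1) - H (n + k)) + (H (n + k) - H n)‖ := by rw [← add_assoc]; ring_nf
        _ ≤ _ := norm_add_le _ _
        _ ≤ _ := add_le_add h1 ih
        _ ≤ _ := by linarith
  have key' : ∀ n : ℕ, 1 ≤ n → ∀ m : ℕ, n ≤ m → ‖H m - H n‖ ≤ K / n := by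
    intro n hn m hm
    obtain ⟨k, rfl⟩ := Nat.exists_eq_add_of_le hm
    refine (key n hn k).trans ?_
    rw [div_eq_mul_one_div K]
    refine mul_le_mul_of_nonneg_left ?_ hK
    have : (0 : ℝ) ≤ 1 / (n + k : ℕ) := by positivity
    linarith
  have hc : CauchySeq H := by
    have ht : Tendsto (fun n : ℕ => K / (n : ℝ)) atTop (𝓝 0) :=
      tendsto_const_div_atTop_nhds_zero_nat K
    rw [Metric.cauchySeq_iff']
    intro ε hε
    obtain ⟨N, hN, hN1⟩ := ((ht.eventually (gt_mem_nhds hε)).and (eventually_ge_atTop 1)).exists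
    exact ⟨N, fun n hn => by rw [dist_eq_norm]; exact (key' N hN1 n hn).trans_lt hN⟩
  obtain ⟨L, hL⟩ := cauchySeq_tendsto_of_complete hc
  refine ⟨L, fun n hn => ?_⟩
  rw [norm_sub_rev]
  refine le_of_tendsto (hL.sub_const (H n)).norm ?_
  filter_upwards [eventually_ge_atTop n] with m hm
  exact key' n hn m hm

theorem exists_norm_le_of_norm_succ_le {K : ℝ} (hK : 0 ≤ K) (N : ℕ) :
    ∃ B : ℝ, 0 < B ∧ ∀ H : ℕ → ℂ,
      (∀ n : ℕ, N < n → ‖H (n + 1)‖ ≤ (1 + K / ((n : ℝ) + 1) ^ 2) * ‖H n‖) →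
      ∀ n : ℕ, N < n → ‖H n‖ ≤ B * ‖H (N + 1)‖ := by
  refine ⟨Real.exp (K / ((N + 1 : ℕ) : ℝ)), Real.exp_pos _, fun H h n hn => ?_⟩
  have key : ‖H n‖ * Real.exp (K / n) ≤ ‖H (N + 1)‖ * Real.exp (K / ((N + 1 : ℕ) : ℝ)) := by
    induction n, hn using Nat.le_induction with
    | base => exact le_rfl
    | succ n hn ih =>
      refine le_trans ?_ ih
      have hn0 : (0 : ℝ) < n := by exact_mod_cast (by omega : 0 < n)
      calc _ ≤ ((1 + K / ((n : ℝ) + 1) ^ 2) * ‖H n‖) * Real.exp (K / (n + 1 : ℕ)) := by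
            gcongr; exact h n hn
        _ ≤ (Real.exp (K / ((n : ℝ) + 1) ^ 2) * ‖H n‖) * Real.exp (K / (n + 1 : ℕ)) := by
            gcongr; linarith [Real.add_one_le_exp (K / ((n : ℝ) + 1) ^ 2)]
        _ = ‖H n‖ * Real.exp (K * (1 / ((n : ℝ) + 1) ^ 2 + 1 / (n + 1))) := by
            rw [mul_comm (Real.exp _), mul_assoc, ← Real.exp_add]; push_cast; ring_nf
        _ ≤ ‖H n‖ * Real.exp (K * (1 / n)) := by
            gcongr
            rw [div_add_div _ _ (by positivity) (by positivity),
              div_le_div_iff₀ (by positivity) (by positivity)]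
            nlinarith
        _ = _ := by rw [mul_one_div]
  have : 1 ≤ Real.exp (K / n) := Real.one_le_exp (by positivity)
  nlinarith [norm_nonneg (H n)]

/-- Solutions of `F (n+1) = F n + γ n * w ^ (n+1) * conj (F n)` converge at rate `1 / n`,
uniformly in the unimodular parameter `w` bounded away from `1`. -/
theorem exists_limit_of_oscillating_recurrence {γ : ℕ → ℝ} {κ η : ℝ} (hη : 0 < η)
    (h1 : ∀ n : ℕ, |γ n| ≤ κ / ((n : ℝ) + 1))
    (h2 : ∀ n : ℕ, |γ (n + 1) - γ n| ≤ κ / ((n : ℝ) + 1) ^ 2) :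
    ∃ C : ℝ, 0 < C ∧ ∀ w : ℂ, ‖w‖ = 1 → η ≤ ‖1 - w‖ → ∀ F : ℕ → ℂ, F 0 = 1 →
      (∀ n, F (n + 1) = F n + γ n * w ^ (n + 1) * (starRingEnd ℂ) (F n)) →
      (∀ n, ‖F n‖ ≤ C) ∧ ∃ L : ℂ, ‖L‖ ≤ C ∧ ∀ n : ℕ, 1 ≤ n → ‖F n - L‖ ≤ C / n := by
  have hκ : 0 ≤ κ := by have := (abs_nonneg _).trans (h1 0); simpa using this
  obtain ⟨N, hN⟩ := exists_nat_ge (2 * κ / η)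
  set K := (κ + κ * κ) / η with hKdef
  have hK : 0 ≤ K := by positivity
  obtain ⟨B, hB, hBH⟩ := exists_norm_le_of_norm_succ_le (K := 2 * K) (by positivity) N
  set B' := (1 + κ) ^ (N + 1) + 2 * (B * ((1 + κ / η) * (1 + κ) ^ (N + 1))) with hB'
  have hB'0 : 0 < B' := by positivity
  refine ⟨B' + (K * B' + κ / η * B'), by positivity, fun w hw hwη F hF0 hF => ?_⟩
  have hw1 : 0 < ‖1 - w‖ := hη.trans_le hwη
  have hw1' : 1 - w ≠ 0 := norm_pos_iff.1 hw1
  have hww : w * (starRingEnd ℂ) w = 1 := by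
    rw [Complex.mul_conj, Complex.normSq_eq_norm_sq, hw]; simp
  set H : ℕ → ℂ := fun n => F n + γ n * w ^ (n + 1) * (starRingEnd ℂ) (F n) / (1 - w) with hH
  have hγκ : ∀ n, |γ n| ≤ κ := fun n => (h1 n).trans (div_le_self hκ (by simp))
  have hdiff : ∀ n, ‖H n - F n‖ ≤ κ / η / ((n : ℝ) + 1) * ‖F n‖ := by
    intro n
    have : H n - F n = γ n * w ^ (n + 1) * (starRingEnd ℂ) (F n) / (1 - w) := by simp [hH]
    rw [this, norm_div, norm_mul, norm_mul, norm_pow, hw, one_pow, mul_one, RCLike.norm_conj,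
      Complex.norm_real, Real.norm_eq_abs]
    calc _ ≤ κ / ((n : ℝ) + 1) * ‖F n‖ / η := by
          gcongr
          exact h1 n
      _ = _ := by ring
  have hstep : ∀ n, ‖H (n + 1) - H n‖ ≤ K / ((n : ℝ) + 1) ^ 2 * ‖F n‖ := by
    intro n
    have hwn : w ^ (n + 1) * (starRingEnd ℂ) w ^ (n + 1) = 1 := by rw [← mul_pow, hww, one_pow]
    have e : H (n + 1) - H n = w ^ (n + 2) * (((γ (n + 1) - γ n : ℝ) : ℂ) * (starRingEnd ℂ) (F n)
        + ((γ (n + 1) * γ n : ℝ) : ℂ) * (starRingEnd ℂ) w ^ (n + 1) * F n) / (1 - w) := by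
      simp only [hH, hF n, map_add, map_mul, map_pow, Complex.conj_conj, Complex.conj_ofReal]
      push_cast
      field_simp
      ring
    rw [e, norm_div, norm_mul, norm_pow, hw, one_pow, one_mul]
    have hn0 : (0 : ℝ) < (n : ℝ) + 1 := by positivity
    have hγγ : |γ (n + 1)| * |γ n| ≤ κ * κ / ((n : ℝ) + 1) ^ 2 := by
      have h3 : |γ (n + 1)| ≤ κ / ((n : ℝ) + 1) := by
        refine (h1 (n + 1)).trans ?_
        push_cast
        gcongr
        linarith
      calc _ ≤ κ / ((n : ℝ) + 1) * (κ / ((n : ℝ) + 1)) := by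
            gcongr
            exact h1 n
        _ = _ := by field_simp
    calc _ ≤ (|γ (n + 1) - γ n| * ‖F n‖ + |γ (n + 1)| * |γ n| * ‖F n‖) / η := by
          gcongr
          refine (norm_add_le _ _).trans (le_of_eq ?_)
          simp only [norm_mul, norm_pow, RCLike.norm_conj, hw, one_pow, mul_one,
            Complex.norm_real, Real.norm_eq_abs]
      _ ≤ (κ / ((n : ℝ) + 1) ^ 2 * ‖F n‖ + κ * κ / ((n : ℝ) + 1) ^ 2 * ‖F n‖) / η := by
          gcongr
          exact h2 n
      _ = _ := by rw [hKdef]; ring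
  have hlow : ∀ n, N < n → ‖F n‖ ≤ 2 * ‖H n‖ := by
    intro n hn
    have hd := hdiff n
    have hc : κ / η / ((n : ℝ) + 1) ≤ 1 / 2 := by
      rw [div_le_iff₀ (by positivity)]
      have : (N : ℝ) < n := by exact_mod_cast hn
      have e : 2 * κ / η = 2 * (κ / η) := by ring
      rw [e] at hN
      linarith
    have h3 : ‖F n‖ ≤ ‖H n‖ + ‖H n - F n‖ := by
      rw [norm_sub_rev]
      simpa using norm_add_le (H n) (F n - H n)
    nlinarith [norm_nonneg (F n)]
  have hsmall : ∀ n, ‖F n‖ ≤ (1 + κ) ^ n := by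
    intro n
    induction n with
    | zero => simp [hF0]
    | succ n ih =>
      rw [hF n]
      refine (norm_add_le _ _).trans ?_
      simp only [norm_mul, norm_pow, RCLike.norm_conj, hw, one_pow, mul_one,
        Complex.norm_real, Real.norm_eq_abs]
      have := mul_le_mul_of_nonneg_right (hγκ n) (norm_nonneg (F n))
      calc _ ≤ (1 + κ) * ‖F n‖ := by linarith
        _ ≤ (1 + κ) * (1 + κ) ^ n := by gcongr
        _ = _ := by ring
  have hbdd : ∀ n, ‖F n‖ ≤ B' := by
    intro n
    rcases lt_or_ge N n with hn | hn
    · have h3 : ∀ n : ℕ, N < n → ‖H (n + 1)‖ ≤ (1 + 2 * K / ((n : ℝ) + 1) ^ 2) * ‖H n‖ := by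
        intro n hn
        have h4 : ‖H (n + 1)‖ ≤ ‖H n‖ + ‖H (n + 1) - H n‖ := by
          simpa using norm_add_le (H n) (H (n + 1) - H n)
        calc _ ≤ ‖H n‖ + K / ((n : ℝ) + 1) ^ 2 * (2 * ‖H n‖) := by
              refine h4.trans (add_le_add le_rfl ((hstep n).trans ?_))
              gcongr
              exact hlow n hn
          _ = _ := by ring
      have h5 : ‖H (N + 1)‖ ≤ (1 + κ / η) * (1 + κ) ^ (N + 1) := by
        have h6 := hdiff (N + 1)
        have h7 : ‖H (N + 1)‖ ≤ ‖F (N + 1)‖ + ‖H (N + 1) - F (N + 1)‖ := by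
          simpa using norm_add_le (F (N + 1)) (H (N + 1) - F (N + 1))
        calc _ ≤ ‖F (N + 1)‖ + κ / η * ‖F (N + 1)‖ := by
              refine h7.trans (add_le_add le_rfl (h6.trans ?_))
              refine mul_le_mul_of_nonneg_right (div_le_self (by positivity) ?_) (norm_nonneg _)
              have : (0 : ℝ) ≤ (N + 1 : ℕ) := by positivity
              linarith
          _ = (1 + κ / η) * ‖F (N + 1)‖ := by ring
          _ ≤ _ := by gcongr; exact hsmall _
      calc _ ≤ 2 * ‖H n‖ := hlow n hn
        _ ≤ 2 * (B * ((1 + κ / η) * (1 + κ) ^ (N + 1))) := by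
          gcongr
          exact (hBH H h3 n hn).trans (by gcongr)
        _ ≤ B' := by rw [hB']; linarith [show 0 < (1 + κ) ^ (N + 1) by positivity]
    · calc _ ≤ (1 + κ) ^ n := hsmall n
        _ ≤ (1 + κ) ^ (N + 1) := by gcongr <;> linarith
        _ ≤ B' := by
          rw [hB']
          have : 0 ≤ 2 * (B * ((1 + κ / η) * (1 + κ) ^ (N + 1))) := by positivity
          linarith
  obtain ⟨L, hL⟩ := exists_limit_of_norm_sub_le (H := H) (K := K * B') (by
    intro n
    refine (hstep n).trans ?_
    rw [div_mul_eq_mul_div]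
    gcongr
    exact hbdd n)
  have hFL : ∀ n : ℕ, 1 ≤ n → ‖F n - L‖ ≤ (K * B' + κ / η * B') / n := by
    intro n hn
    have hn0 : (0 : ℝ) < n := by exact_mod_cast hn
    calc _ = ‖(H n - L) - (H n - F n)‖ := by ring_nf
      _ ≤ _ := norm_sub_le _ _
      _ ≤ K * B' / n + κ / η / n * B' := by
        refine add_le_add (hL n hn) ((hdiff n).trans ?_)
        gcongr
        · linarith
        · exact hbdd n
      _ = _ := by ring
  refine ⟨fun n => (hbdd n).trans (by
    have : 0 ≤ K * B' + κ / η * B' := by positivity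
    linarith), L, ?_, fun n hn => (hFL n hn).trans
    (div_le_div_of_nonneg_right (by linarith) (by positivity))⟩
  calc ‖L‖ = ‖F 1 - (F 1 - L)‖ := by ring_nf
    _ ≤ _ := norm_sub_le _ _
    _ ≤ _ := add_le_add (hbdd 1) (by simpa using hFL 1 le_rfl)

/-- An Abelian theorem: if `F n → L`, the power series with coefficients `a n * F n`, where `a n`
are the coefficients of `(1 - z)^{-α}`, is asymptotic to `L (1 - z)^{-α}` as `z → 1⁻`. -/
theorem tendsto_one_sub_cpow_mul_of_tendsto {α : ℝ} (hα : 0 < α) {F : ℕ → ℂ} {L : ℂ}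
    (hF : Tendsto F atTop (𝓝 L)) {S : ℝ → ℂ}
    (hS : ∀ z ∈ Set.Ioo (0 : ℝ) 1,
      HasSum (fun n => ((Ring.multichoose α n : ℝ) : ℂ) * F n * (z : ℂ) ^ n) (S z)) :
    Tendsto (fun z : ℝ => ((1 - z : ℝ) : ℂ) ^ (α : ℂ) * S z) (𝓝[<] 1) (𝓝 L) := by
  have hα_pos : ∀ n, 0 < Ring.multichoose α n := multichoose_pos hα
  have hrpow : Tendsto (fun z : ℝ => (1 - z) ^ α) (𝓝[<] 1) (𝓝 0) := by
    have : ContinuousAt (fun z : ℝ => (1 - z) ^ α) 1 :=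
      ContinuousAt.rpow_const (by fun_prop) (Or.inr hα.le)
    have h := this.tendsto
    simp only [sub_self, Real.zero_rpow hα.ne'] at h
    exact h.mono_left nhdsWithin_le_nhds
  rw [Metric.tendsto_nhds]
  intro ε hε
  obtain ⟨N, hN⟩ := (Metric.tendsto_atTop.1 hF) (ε / 2) (by positivity)
  set c : ℕ → ℝ := fun n => if n < N then Ring.multichoose α n * ‖F n - L‖ else 0 with hc
  set K : ℝ := ∑ n ∈ Finset.range N, c n with hK
  have hKs : HasSum c K := hasSum_sum_of_ne_finset_zero fun n hn => by
    rw [Finset.mem_range] at hn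
    simp [hc, hn]
  have hlim : Tendsto (fun z : ℝ => (1 - z) ^ α * K + ε / 2) (𝓝[<] 1) (𝓝 (ε / 2)) := by
    simpa using (hrpow.mul_const K).add_const (ε / 2)
  have hIoo : Set.Ioo (0 : ℝ) 1 ∈ 𝓝[<] (1 : ℝ) := Ioo_mem_nhdsLT one_pos
  filter_upwards [hlim.eventually (gt_mem_nhds (half_lt_self hε)), hIoo] with z hz1 hz
  refine lt_of_le_of_lt ?_ hz1
  have h1z : 0 < 1 - z := by linarith [hz.2]
  have hzn : ‖(z : ℂ)‖ < 1 := by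
    rw [Complex.norm_real, Real.norm_eq_abs, abs_of_pos hz.1]; exact hz.2
  have hp : 0 < (1 - z) ^ α := Real.rpow_pos_of_pos h1z α
  have hcp : ((1 - z : ℝ) : ℂ) ^ (α : ℂ) = (((1 - z) ^ α : ℝ) : ℂ) :=
    (Complex.ofReal_cpow h1z.le α).symm
  have hA := hasSum_multichoose_mul_pow α hzn
  rw [show (1 : ℂ) - z = ((1 - z : ℝ) : ℂ) by push_cast; ring, hcp] at hA
  have hAr : HasSum (fun n => Ring.multichoose α n * z ^ n) (1 / (1 - z) ^ α) := by
    rw [← Complex.hasSum_ofReal]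
    push_cast at hA ⊢
    exact hA
  have hdiff := (hS z hz).sub (hA.mul_right L)
  have hbound := hdiff.norm_le_of_bounded (hKs.add (hAr.mul_left (ε / 2))) fun n => by
    have e : ((Ring.multichoose α n : ℝ) : ℂ) * F n * (z : ℂ) ^ n
        - ((Ring.multichoose α n : ℝ) : ℂ) * (z : ℂ) ^ n * L
        = ((Ring.multichoose α n : ℝ) : ℂ) * (z : ℂ) ^ n * (F n - L) := by ring
    rw [e, norm_mul, norm_mul, norm_pow, Complex.norm_real, Complex.norm_real, Real.norm_eq_abs,
      Real.norm_eq_abs, abs_of_pos hz.1, abs_of_pos (hα_pos n)]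
    have ha := hα_pos n
    have hz0 := hz.1
    by_cases hn : n < N
    · simp only [hc, hn, if_true]
      have : z ^ n ≤ 1 := pow_le_one₀ hz.1.le hz.2.le
      calc _ ≤ Ring.multichoose α n * 1 * ‖F n - L‖ := by gcongr
        _ = Ring.multichoose α n * ‖F n - L‖ := by ring
        _ ≤ _ := le_add_of_nonneg_right (by positivity)
    · simp only [hc, hn, if_false, zero_add]
      have := (hN n (not_lt.1 hn)).le
      rw [dist_eq_norm] at this
      calc _ ≤ Ring.multichoose α n * z ^ n * (ε / 2) := by gcongr
        _ = _ := by ring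
  rw [dist_eq_norm, hcp]
  have e : (((1 - z) ^ α : ℝ) : ℂ) * S z - L
      = (((1 - z) ^ α : ℝ) : ℂ) * (S z - 1 / (((1 - z) ^ α : ℝ) : ℂ) * L) := by
    have : (((1 - z) ^ α : ℝ) : ℂ) ≠ 0 := by exact_mod_cast hp.ne'
    field_simp
  rw [e, norm_mul, Complex.norm_real, Real.norm_eq_abs, abs_of_pos hp]
  calc _ ≤ (1 - z) ^ α * (K + ε / 2 * (1 / (1 - z) ^ α)) := by gcongr
    _ = _ := by field_simp

/-- The limit of the normalised coefficients of `(1 - z)^{-α} (1 - w z)^{1 - α}`. -/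
theorem limit_binomialConv_div_eq {α : ℝ} (hα : 0 < α) {w L : ℂ} (hw : ‖w‖ = 1) (hw1 : w ≠ 1)
    (hL : Tendsto (fun n => binomialConv α (α - 1) w n / ((Ring.multichoose α n : ℝ) : ℂ))
      atTop (𝓝 L)) :
    L = (1 - w) ^ (1 - α : ℂ) := by
  have ha : ∀ n, ((Ring.multichoose α n : ℝ) : ℂ) ≠ 0 := fun n => by
    exact_mod_cast (multichoose_pos hα n).ne'
  have h := tendsto_one_sub_cpow_mul_of_tendsto hα hL
    (S := fun z => 1 / (1 - (z : ℂ)) ^ (α : ℂ) * (1 / (1 - w * z) ^ ((α - 1 : ℝ) : ℂ)))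
    fun z hz => by
      have hzn : ‖(z : ℂ)‖ < 1 := by
        rw [Complex.norm_real, Real.norm_eq_abs, abs_of_pos hz.1]; exact hz.2
      have e : (fun n => ((Ring.multichoose α n : ℝ) : ℂ)
          * (binomialConv α (α - 1) w n / ((Ring.multichoose α n : ℝ) : ℂ)) * (z : ℂ) ^ n)
          = fun n => binomialConv α (α - 1) w n * (z : ℂ) ^ n := by
        funext n
        rw [mul_div_cancel₀ _ (ha n)]
      rw [e]
      exact hasSum_binomialConv α (α - 1) hw hzn
  have hre : w.re < 1 := by
    refine lt_of_le_of_ne ((Complex.re_le_norm w).trans hw.le) fun hre => hw1 ?_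
    have h2 := Complex.sq_norm_sub_sq_re w
    rw [hw, hre] at h2
    have h3 : w.im = 0 := by nlinarith
    exact Complex.ext (by simpa using hre) (by simpa using h3)
  have hslit : (1 : ℂ) - w * (1 : ℝ) ∈ Complex.slitPlane := by
    left; simpa using hre
  have hcont : ContinuousAt (fun z : ℝ => (1 - w * (z : ℂ)) ^ (1 - α : ℂ)) 1 :=
    ContinuousAt.cpow (by fun_prop) continuousAt_const hslit
  have h' := hcont.tendsto.mono_left (nhdsWithin_le_nhds (s := Set.Iio 1))
  simp only [Complex.ofReal_one, mul_one] at h'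
  refine tendsto_nhds_unique h (h'.congr' ?_)
  filter_upwards [self_mem_nhdsWithin] with z hz
  have h1z : (0 : ℝ) < 1 - z := by linarith [Set.mem_Iio.1 hz]
  have hne : ((1 - z : ℝ) : ℂ) ^ (α : ℂ) ≠ 0 := by
    rw [← Complex.ofReal_cpow h1z.le]
    exact_mod_cast (Real.rpow_pos_of_pos h1z α).ne'
  rw [show (1 : ℂ) - z = ((1 - z : ℝ) : ℂ) by push_cast; ring,
    show (1 - α : ℂ) = -((α - 1 : ℝ) : ℂ) by push_cast; ring, Complex.cpow_neg]
  field_simp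

theorem binomialConv_self_exp_eq_gegenbauer (α θ : ℝ) (n : ℕ) :
    binomialConv α α (Complex.exp (-(2 * θ * Complex.I))) n
      = Complex.exp (-(θ * Complex.I)) ^ n * (gegenbauer α n (Real.cos θ) : ℝ) := by
  set ζ := Complex.exp (-(θ * Complex.I)) with hζ
  have hw : Complex.exp (-(2 * θ * Complex.I)) = ζ ^ 2 := by
    rw [hζ, ← Complex.exp_nat_mul]; push_cast; ring_nf
  have hcos : 2 * ζ * Complex.cos θ = 1 + ζ ^ 2 := by
    have h := Complex.exp_ne_zero (θ * Complex.I)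
    rw [Complex.cos, hζ, neg_mul, Complex.exp_neg]
    field_simp
  rw [hw]
  induction n using Nat.strong_induction_on with
  | _ n ih =>
    match n with
    | 0 => simp [binomialConv_zero, gegenbauer]
    | 1 =>
      rw [binomialConv_one]
      simp only [gegenbauer]
      push_cast
      linear_combination -α * hcos
    | n + 2 =>
      have h0 := ih n (by omega)
      have h1 := ih (n + 1) (by omega)
      have hn : (n : ℂ) + 2 ≠ 0 := by exact_mod_cast (by omega : n + 2 ≠ 0)
      apply mul_left_cancel₀ hn
      rw [binomialConv_self_rec, h0, h1]
      simp only [gegenbauer]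
      push_cast
      field_simp
      linear_combination (-ζ ^ (n + 1) * (n + 1 + α) * gegenbauer α (n + 1) (Real.cos θ)) * hcos

theorem binomialConv_sub_one_exp_succ (α θ : ℝ) (n : ℕ) :
    Complex.exp (θ * Complex.I) ^ (n + 2)
        * binomialConv α (α - 1) (Complex.exp (-(2 * θ * Complex.I))) (n + 1)
      = Complex.exp (θ * Complex.I) * (gegenbauer α (n + 1) (Real.cos θ) : ℝ)
        - (gegenbauer α n (Real.cos θ) : ℝ) := by
  rw [binomialConv_sub_one_succ, binomialConv_self_exp_eq_gegenbauer,
    binomialConv_self_exp_eq_gegenbauer]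
  have hw : Complex.exp (-(2 * θ * Complex.I)) = Complex.exp (-(θ * Complex.I)) ^ 2 := by
    rw [← Complex.exp_nat_mul]; push_cast; ring_nf
  rw [hw, Complex.exp_neg]
  simp only [inv_pow]
  have h := Complex.exp_ne_zero (θ * Complex.I)
  field_simp
  ring

theorem sin_mul_gegenbauer_cos (α θ : ℝ) (n : ℕ) :
    Real.sin θ * gegenbauer α n (Real.cos θ)
      = (Complex.exp (θ * Complex.I) ^ (n + 1)
        * binomialConv α (α - 1) (Complex.exp (-(2 * θ * Complex.I))) n).im := by
  cases n with
  | zero => simp [binomialConv_zero, gegenbauer, Complex.exp_ofReal_mul_I_im]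
  | succ n =>
    rw [binomialConv_sub_one_exp_succ, Complex.sub_im, Complex.im_mul_ofReal,
      Complex.exp_ofReal_mul_I_im, Complex.ofReal_im, sub_zero]

theorem binomialConv_sub_one_exp_rec (α θ : ℝ) (n : ℕ) :
    ((n : ℂ) + 1) * binomialConv α (α - 1) (Complex.exp (-(2 * θ * Complex.I))) (n + 1)
      = (n + α) * binomialConv α (α - 1) (Complex.exp (-(2 * θ * Complex.I))) n
        + (α - 1) * Complex.exp (-(2 * θ * Complex.I)) ^ (n + 1)
          * (starRingEnd ℂ) (binomialConv α (α - 1) (Complex.exp (-(2 * θ * Complex.I))) n) := by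
  set w := Complex.exp (-(2 * θ * Complex.I)) with hw
  cases n with
  | zero =>
    rw [binomialConv_one, binomialConv_zero]
    push_cast
    simp
  | succ n =>
    have hrec := binomialConv_self_rec α w n
    have hconj : w ^ (n + 1) * (starRingEnd ℂ) (binomialConv α (α - 1) w (n + 1))
        = binomialConv α α w (n + 1) - binomialConv α α w n := by
      rw [binomialConv_sub_one_succ, hw, binomialConv_self_exp_eq_gegenbauer,
        binomialConv_self_exp_eq_gegenbauer]
      have hw2 : Complex.exp (-(2 * θ * Complex.I)) = Complex.exp (-(θ * Complex.I)) ^ 2 := by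
        rw [← Complex.exp_nat_mul]; push_cast; ring_nf
      have hζ : (starRingEnd ℂ) (Complex.exp (-(θ * Complex.I))) = Complex.exp (θ * Complex.I) := by
        rw [← Complex.exp_conj]; simp
      simp only [hw2, map_sub, map_mul, map_pow, hζ, Complex.conj_ofReal]
      rw [Complex.exp_neg]
      simp only [inv_pow]
      have h := Complex.exp_ne_zero (θ * Complex.I)
      field_simp
      ring
    rw [pow_succ, mul_comm (w ^ (n + 1)) w, ← mul_assoc, mul_assoc _ (w ^ (n + 1)), hconj,
      binomialConv_sub_one_succ, binomialConv_sub_one_succ]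
    push_cast
    linear_combination hrec

theorem one_sub_exp_cpow {θ : ℝ} (h0 : 0 < θ) (hπ : θ < Real.pi) (c : ℂ) :
    (1 - Complex.exp (-(2 * θ * Complex.I))) ^ c
      = Complex.exp ((Real.log (2 * Real.sin θ) + (Real.pi / 2 - θ : ℝ) * Complex.I) * c) := by
  have hs : 0 < 2 * Real.sin θ := by
    have := Real.sin_pos_of_pos_of_lt_pi h0 hπ
    positivity
  have e : 1 - Complex.exp (-(2 * θ * Complex.I))
      = (2 * Real.sin θ : ℝ) * Complex.exp ((Real.pi / 2 - θ : ℝ) * Complex.I) := by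
    have h1 : Complex.exp (-(2 * θ * Complex.I)) = Complex.exp (-(θ * Complex.I)) ^ 2 := by
      rw [← Complex.exp_nat_mul]; push_cast; ring_nf
    have h2 : Complex.exp ((Real.pi / 2 - θ : ℝ) * Complex.I)
        = Complex.I * Complex.exp (-(θ * Complex.I)) := by
      have h3 := Complex.exp_add (Real.pi / 2 * Complex.I) (-(θ * Complex.I))
      rw [Complex.exp_pi_div_two_mul_I] at h3
      rw [← h3]; push_cast; ring_nf
    have h := Complex.exp_ne_zero (θ * Complex.I)
    rw [h1, h2]
    push_cast
    rw [Complex.sin, neg_mul, Complex.exp_neg]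
    field_simp
    linear_combination (Complex.exp (θ * Complex.I) ^ 2 - 1) * Complex.I_sq
  have hne : 1 - Complex.exp (-(2 * θ * Complex.I)) ≠ 0 := by
    rw [e]
    exact mul_ne_zero (by exact_mod_cast hs.ne') (Complex.exp_ne_zero _)
  rw [Complex.cpow_def_of_ne_zero hne, e, Complex.log_ofReal_mul hs (Complex.exp_ne_zero _),
    Complex.log_exp (by simp; linarith) (by simp; linarith)]

theorem im_exp_pow_mul_one_sub_exp_cpow {θ : ℝ} (h0 : 0 < θ) (hπ : θ < Real.pi) (α : ℝ) (n : ℕ) :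
    (Complex.exp (θ * Complex.I) ^ (n + 1)
        * (1 - Complex.exp (-(2 * θ * Complex.I))) ^ (1 - α : ℂ)).im
      = (2 * Real.sin θ) ^ (1 - α) * Real.cos ((n + α) * θ - α * Real.pi / 2) := by
  have hs : 0 < 2 * Real.sin θ := by
    have := Real.sin_pos_of_pos_of_lt_pi h0 hπ
    positivity
  have e : Complex.exp (θ * Complex.I) ^ (n + 1)
        * (1 - Complex.exp (-(2 * θ * Complex.I))) ^ (1 - α : ℂ)
      = ((Real.exp (Real.log (2 * Real.sin θ) * (1 - α)) : ℝ) : ℂ)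
        * Complex.exp ((((n + α) * θ - α * Real.pi / 2 + Real.pi / 2 : ℝ) : ℂ) * Complex.I) := by
    rw [one_sub_exp_cpow h0 hπ, ← Complex.exp_nat_mul, Complex.ofReal_exp, ← Complex.exp_add,
      ← Complex.exp_add]
    push_cast
    ring_nf
  rw [e, Complex.im_ofReal_mul, Complex.exp_ofReal_mul_I_im, Real.sin_add_pi_div_two,
    Real.rpow_def_of_pos hs]

theorem sin_le_sin_of_mem_Icc {δ θ : ℝ} (h0 : 0 < δ) (h1 : δ < Real.pi / 2)
    (hθ : θ ∈ Set.Icc δ (Real.pi - δ)) : Real.sin δ ≤ Real.sin θ := by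
  rcases le_total θ (Real.pi / 2) with h | h
  · exact Real.sin_le_sin_of_le_of_le_pi_div_two (by linarith) h hθ.1
  · rw [← Real.sin_pi_sub θ]
    exact Real.sin_le_sin_of_le_of_le_pi_div_two (by linarith) (by linarith) (by linarith [hθ.2])

theorem norm_one_sub_exp (θ : ℝ) :
    ‖1 - Complex.exp (-(2 * θ * Complex.I))‖ = 2 * |Real.sin θ| := by
  have h := Complex.norm_exp_I_mul_ofReal_sub_one (-(2 * θ))
  rw [norm_sub_rev, show -(2 * θ * Complex.I : ℂ) = Complex.I * ((-(2 * θ) : ℝ) : ℂ) by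
    push_cast; ring, h, show -(2 * θ) / 2 = -θ by ring, Real.sin_neg]
  simp

/-- The limit of the normalised coefficients, with a uniform `O(1 / n)` rate. -/
theorem exists_norm_binomialConv_div_sub_le {α δ : ℝ} (hα : 0 < α)
    (hδ : δ ∈ Set.Ioo 0 (Real.pi / 2)) :
    ∃ C : ℝ, 0 < C ∧ ∀ θ ∈ Set.Icc δ (Real.pi - δ),
      ‖(1 - Complex.exp (-(2 * θ * Complex.I))) ^ (1 - α : ℂ)‖ ≤ C ∧
      (∀ n, ‖binomialConv α (α - 1) (Complex.exp (-(2 * θ * Complex.I))) n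
        / ((Ring.multichoose α n : ℝ) : ℂ)‖ ≤ C) ∧
      ∀ n : ℕ, 1 ≤ n → ‖binomialConv α (α - 1) (Complex.exp (-(2 * θ * Complex.I))) n
          / ((Ring.multichoose α n : ℝ) : ℂ)
        - (1 - Complex.exp (-(2 * θ * Complex.I))) ^ (1 - α : ℂ)‖ ≤ C / n := by
  obtain ⟨hδ0, hδ1⟩ := hδ
  have hsδ : 0 < Real.sin δ := Real.sin_pos_of_pos_of_lt_pi hδ0 (by linarith [Real.pi_pos])
  set m := min 1 α with hm
  have hm0 : 0 < m := lt_min one_pos hα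
  have hm1 : m ≤ 1 := min_le_left _ _
  have hmα : m ≤ α := min_le_right _ _
  have hmn : ∀ n : ℕ, m * ((n : ℝ) + 1) ≤ n + α := fun n => by
    nlinarith [show (0 : ℝ) ≤ n by positivity]
  obtain ⟨C, hC, h⟩ := exists_limit_of_oscillating_recurrence
    (γ := fun n => (α - 1) / (n + α)) (κ := |α - 1| / m ^ 2) hsδ
    (fun n => by
      rw [abs_div, abs_of_pos (by positivity : 0 < (n : ℝ) + α), div_div]
      gcongr
      refine le_trans ?_ (hmn n)
      gcongr
      nlinarith)
    (fun n => by
      have hn : 0 < (n : ℝ) + α := by positivity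
      have hn1 : 0 < ((n + 1 : ℕ) : ℝ) + α := by positivity
      have e : (α - 1) / (((n + 1 : ℕ) : ℝ) + α) - (α - 1) / (n + α)
          = -((α - 1) / ((((n + 1 : ℕ) : ℝ) + α) * (n + α))) := by
        field_simp
        push_cast
        ring
      rw [e, abs_neg, abs_div, abs_of_pos (mul_pos hn1 hn), div_div, ← mul_pow, sq]
      have h1 := hmn n
      have h2 : m * ((n : ℝ) + 1) ≤ ((n + 1 : ℕ) : ℝ) + α := by push_cast; linarith
      gcongr)
  refine ⟨C, hC, fun θ hθ => ?_⟩
  have hθ0 : 0 < θ := hδ0.trans_le hθ.1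
  have hs : Real.sin δ ≤ Real.sin θ := sin_le_sin_of_mem_Icc hδ0 hδ1 hθ
  have hw : ‖Complex.exp (-(2 * θ * Complex.I))‖ = 1 := by
    rw [show -(2 * θ * Complex.I : ℂ) = ((-(2 * θ) : ℝ) : ℂ) * Complex.I by push_cast; ring]
    exact Complex.norm_exp_ofReal_mul_I _
  have hη : Real.sin δ ≤ ‖1 - Complex.exp (-(2 * θ * Complex.I))‖ := by
    rw [norm_one_sub_exp, abs_of_pos (hsδ.trans_le hs)]
    linarith
  have hw1 : Complex.exp (-(2 * θ * Complex.I)) ≠ 1 := fun h => by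
    rw [h, sub_self, norm_zero] at hη
    linarith
  obtain ⟨hB, L, hL, hFL⟩ := h _ hw hη
    (fun n => binomialConv α (α - 1) (Complex.exp (-(2 * θ * Complex.I))) n
      / ((Ring.multichoose α n : ℝ) : ℂ)) (by simp [binomialConv_zero]) (fun n => by
      have ha : ((Ring.multichoose α n : ℝ) : ℂ) ≠ 0 := by
        exact_mod_cast (multichoose_pos hα n).ne'
      have ha1 : ((Ring.multichoose α (n + 1) : ℝ) : ℂ) ≠ 0 := by
        exact_mod_cast (multichoose_pos hα (n + 1)).ne'
      have hr := binomialConv_sub_one_exp_rec α θ n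
      have hm := congrArg (fun x : ℝ => (x : ℂ)) (succ_mul_multichoose_succ α n)
      push_cast at hm
      have hn : (n : ℂ) + α ≠ 0 := by
        exact_mod_cast (by positivity : (n : ℝ) + α ≠ 0)
      have hn1 : (n : ℂ) + 1 ≠ 0 := by exact_mod_cast (by omega : n + 1 ≠ 0)
      rw [map_div₀, Complex.conj_ofReal]
      push_cast
      rw [div_eq_iff ha1]
      apply mul_left_cancel₀ hn1
      rw [hr]
      field_simp
      linear_combination (-((n + α) * binomialConv α (α - 1) (Complex.exp (-(2 * θ * Complex.I))) n
        + (α - 1) * Complex.exp (-(2 * θ * Complex.I)) ^ (n + 1)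
          * (starRingEnd ℂ) (binomialConv α (α - 1) (Complex.exp (-(2 * θ * Complex.I))) n))) * hm)
  have ht : Tendsto (fun n => binomialConv α (α - 1) (Complex.exp (-(2 * θ * Complex.I))) n
      / ((Ring.multichoose α n : ℝ) : ℂ)) atTop (𝓝 L) := by
    rw [tendsto_iff_norm_sub_tendsto_zero]
    refine squeeze_zero' (Eventually.of_forall fun n => norm_nonneg _) ?_
      (tendsto_const_div_atTop_nhds_zero_nat C)
    filter_upwards [eventually_ge_atTop 1] with n hn using hFL n hn
  rw [← limit_binomialConv_div_eq hα hw hw1 ht]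
  exact ⟨hL, hB, hFL⟩

/-- Uniform interior pointwise asymptotics of Gegenbauer polynomials:
for `α > 0` and `δ ∈ (0,π/2)` there are `C > 0`, `L ∈ ℕ` with
`|C_ℓ^{(α)}(cos θ) − (2^{1−α}/Γ(α)) ℓ^{α−1} (sin θ)^{−α} cos((ℓ+α)θ − απ/2)| ≤ C ℓ^{α−2}`
for all `ℓ ≥ L` and `θ ∈ [δ, π−δ]`; in particular `|C_ℓ^{(α)}(cos θ)| ≤ C ℓ^{α−1}` for
all `ℓ ≥ 1` uniformly on `[δ, π−δ]`. -/
theorem stmt_17 (α : ℝ) (hα : 0 < α) (δ : ℝ) (hδ : δ ∈ Set.Ioo 0 (Real.pi / 2)) :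
    (∃ C : ℝ, 0 < C ∧ ∃ L : ℕ, ∀ ℓ : ℕ, L ≤ ℓ →
      ∀ θ ∈ Set.Icc δ (Real.pi - δ),
        |gegenbauer α ℓ (Real.cos θ)
          - (2 : ℝ) ^ (1 - α) / Real.Gamma α * (ℓ : ℝ) ^ (α - 1)
              * Real.sin θ ^ (-α)
              * Real.cos (((ℓ : ℝ) + α) * θ - α * Real.pi / 2)|
          ≤ C * (ℓ : ℝ) ^ (α - 2)) ∧
    (∃ C : ℝ, 0 < C ∧ ∀ ℓ : ℕ, 1 ≤ ℓ → ∀ θ ∈ Set.Icc δ (Real.pi - δ),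
      |gegenbauer α ℓ (Real.cos θ)| ≤ C * (ℓ : ℝ) ^ (α - 1)) := by
  obtain ⟨C, hC, h⟩ := exists_norm_binomialConv_div_sub_le hα hδ
  obtain ⟨A, hA, hmc⟩ := exists_abs_multichoose_sub_le hα
  have hG := Real.Gamma_pos_of_pos hα
  have hsδ : 0 < Real.sin δ :=
    Real.sin_pos_of_pos_of_lt_pi hδ.1 (by linarith [Real.pi_pos, hδ.2])
  set A' := A + 1 / Real.Gamma α with hA'
  have hA'0 : 0 < A' := by positivity
  have hmc' : ∀ n : ℕ, 1 ≤ n → Ring.multichoose α n ≤ A' * (n : ℝ) ^ (α - 1) := by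
    intro n hn
    have hn1 : (1 : ℝ) ≤ n := by exact_mod_cast hn
    have hpow : (n : ℝ) ^ (α - 2) ≤ (n : ℝ) ^ (α - 1) :=
      Real.rpow_le_rpow_of_exponent_le hn1 (by linarith)
    have h1 := (abs_le.1 (hmc n hn)).2
    have h2 : A * (n : ℝ) ^ (α - 2) ≤ A * (n : ℝ) ^ (α - 1) := by gcongr
    rw [hA', add_mul, one_div_mul_eq_div]
    linarith
  have hsin : ∀ θ ∈ Set.Icc δ (Real.pi - δ), Real.sin δ ≤ Real.sin θ := fun θ hθ =>
    sin_le_sin_of_mem_Icc hδ.1 hδ.2 hθ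
  have hexp : ∀ (θ : ℝ) (n : ℕ), ‖Complex.exp (θ * Complex.I) ^ n‖ = 1 := fun θ n => by
    rw [norm_pow, Complex.norm_exp_ofReal_mul_I, one_pow]
  have hle : ∀ θ ∈ Set.Icc δ (Real.pi - δ), ∀ x B : ℝ, |Real.sin θ * x| ≤ B →
      |x| ≤ B / Real.sin δ := by
    intro θ hθ x B hx
    rw [le_div_iff₀ hsδ]
    rw [abs_mul, abs_of_pos (hsδ.trans_le (hsin θ hθ))] at hx
    nlinarith [hsin θ hθ, abs_nonneg x]
  have hconv : ∀ (w : ℂ) (n : ℕ), binomialConv α (α - 1) w n = ((Ring.multichoose α n : ℝ) : ℂ)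
      * (binomialConv α (α - 1) w n / ((Ring.multichoose α n : ℝ) : ℂ)) := fun w n => by
    rw [mul_div_cancel₀]
    exact_mod_cast (multichoose_pos hα n).ne'
  refine ⟨⟨(A' * C + A * C) / Real.sin δ, by positivity, 1, fun n hn θ hθ => ?_⟩,
    ⟨A' * C / Real.sin δ, by positivity, fun n hn θ hθ => ?_⟩⟩
  · have hn0 : (0 : ℝ) < n := by exact_mod_cast hn
    obtain ⟨hL, -, hFL⟩ := h θ hθ
    replace hFL := hFL n hn
    rw [div_mul_eq_mul_div _ (Real.sin δ)]
    refine hle θ hθ _ _ ?_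
    have hθ0 : 0 < θ := hδ.1.trans_le hθ.1
    have hθπ : θ < Real.pi := by linarith [hθ.2, hδ.1]
    have hs : 0 < Real.sin θ := hsδ.trans_le (hsin θ hθ)
    have hmain : Real.sin θ * ((2 : ℝ) ^ (1 - α) / Real.Gamma α * (n : ℝ) ^ (α - 1)
          * Real.sin θ ^ (-α) * Real.cos (((n : ℝ) + α) * θ - α * Real.pi / 2))
        = (Complex.exp (θ * Complex.I) ^ (n + 1)
            * ((((n : ℝ) ^ (α - 1) / Real.Gamma α : ℝ) : ℂ)
              * (1 - Complex.exp (-(2 * θ * Complex.I))) ^ (1 - α : ℂ))).im := by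
      rw [mul_left_comm (Complex.exp (θ * Complex.I) ^ (n + 1)), Complex.im_ofReal_mul,
        im_exp_pow_mul_one_sub_exp_cpow hθ0 hθπ, Real.mul_rpow two_pos.le hs.le, show (1 - α : ℝ) = -α + 1 by ring,
        Real.rpow_add_one hs.ne' (-α)]
      ring
    rw [mul_sub, hmain, sin_mul_gegenbauer_cos, ← Complex.sub_im, ← mul_sub]
    refine (Complex.abs_im_le_norm _).trans ?_
    rw [norm_mul, hexp, one_mul, hconv]
    set a := Ring.multichoose α n
    set F := binomialConv α (α - 1) (Complex.exp (-(2 * θ * Complex.I))) n / ((a : ℝ) : ℂ)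
    set L := (1 - Complex.exp (-(2 * θ * Complex.I))) ^ (1 - α : ℂ)
    have ha0 : 0 < a := multichoose_pos hα n
    have hpow : (n : ℝ) ^ (α - 1) = n ^ (α - 2) * n := by
      rw [show α - 2 = α - 1 - 1 by ring, Real.rpow_sub_one hn0.ne' (α - 1)]
      field_simp
    calc _ = ‖(a : ℂ) * (F - L) + ((a - (n : ℝ) ^ (α - 1) / Real.Gamma α : ℝ) : ℂ) * L‖ := by
          push_cast; ring_nf
      _ ≤ ‖(a : ℂ) * (F - L)‖ + ‖((a - (n : ℝ) ^ (α - 1) / Real.Gamma α : ℝ) : ℂ) * L‖ :=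
          norm_add_le _ _
      _ ≤ (A' * (n : ℝ) ^ (α - 1)) * (C / n) + (A * (n : ℝ) ^ (α - 2)) * C := by
          rw [norm_mul, norm_mul, Complex.norm_real, Complex.norm_real, Real.norm_eq_abs,
            Real.norm_eq_abs, abs_of_pos ha0]
          gcongr
          · exact hmc' n hn
          · exact hmc n hn
      _ = _ := by
          rw [hpow]
          field_simp
  · obtain ⟨-, hB, -⟩ := h θ hθ
    rw [div_mul_eq_mul_div _ (Real.sin δ)]
    refine hle θ hθ _ _ ?_
    rw [sin_mul_gegenbauer_cos]
    refine (Complex.abs_im_le_norm _).trans ?_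
    rw [norm_mul, hexp, one_mul, hconv, norm_mul, Complex.norm_real, Real.norm_eq_abs,
      abs_of_pos (multichoose_pos hα n)]
    calc _ ≤ (A' * (n : ℝ) ^ (α - 1)) * C := by
          gcongr
          · exact hmc' n hn
          · exact hB n
      _ = _ := by ring
end
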